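/- arXiv:2206.05171 — 13 statements merged into one kernel-verified Lean document; each statement's English description precedes it below -/
import Mathlib

section
/- For every integer k ≥ 1 and every θ ∈ ℝ, the determinant of the k×k Hermitian matrix f_k(θ) satisfies det(f_k(θ)) = d_k · (2 − 2cos θ), where d_k = det([⟨L_j', L_i'⟩]_{i,j=1}^{k}) (with the convention d_1 = 1, the determinant of the empty matrix). -/
open scoped BigOperators
open Matrix

/-- Lagrange polynomial `L_i` for the equispaced nodes `t_j = j/k` in `[0,1]`. -/
noncomputable def Lag (k i : ℕ) : ℝ → ℝ :=
  fun t => ∏ j ∈ (Finset.range (k + 1)).erase i, ((k : ℝ) * t - (j : ℝ)) / ((i : ℝ) - (j : ℝ))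

/-- Inner product `⟨φ,ψ⟩ = ∫_0^1 φ ψ`. -/
noncomputable def ip (φ ψ : ℝ → ℝ) : ℝ := ∫ t in (0:ℝ)..1, φ t * ψ t

/-- The block `K_0`: `(K_0)_{i,j} = ⟨L_j',L_i'⟩` for `1 ≤ i,j ≤ k`, except that the
`(k,k)` entry is `⟨L_k',L_k'⟩ + ⟨L_0',L_0'⟩`. -/
noncomputable def K0 (k : ℕ) : Matrix (Fin k) (Fin k) ℝ :=
  Matrix.of fun i j =>
    ip (deriv (Lag k (j.1 + 1))) (deriv (Lag k (i.1 + 1))) +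
      (if i.1 = k - 1 ∧ j.1 = k - 1 then ip (deriv (Lag k 0)) (deriv (Lag k 0)) else 0)

/-- The block `K_1`: `(K_1)_{i,j} = 0` for `j < k` and `(K_1)_{i,k} = ⟨L_0',L_i'⟩`. -/
noncomputable def K1 (k : ℕ) : Matrix (Fin k) (Fin k) ℝ :=
  Matrix.of fun i j =>
    if j.1 = k - 1 then ip (deriv (Lag k 0)) (deriv (Lag k (i.1 + 1))) else 0

/-- The Hermitian matrix-valued symbol `f_k(θ) = K_0 + K_1 e^{iθ} + K_1ᵀ e^{-iθ}`. -/
noncomputable def fSymb (k : ℕ) (θ : ℝ) : Matrix (Fin k) (Fin k) ℂ :=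
  (K0 k).map (fun x => (x : ℂ))
    + Complex.exp (Complex.I * (θ : ℂ)) • (K1 k).map (fun x => (x : ℂ))
    + Complex.exp (-(Complex.I * (θ : ℂ))) • ((K1 k)ᵀ).map (fun x => (x : ℂ))

/-- `d_k = det([⟨L_j',L_i'⟩]_{i,j=1}^k)`. -/
noncomputable def dk (k : ℕ) : ℝ :=
  (Matrix.of fun i j : Fin k => ip (deriv (Lag k (j.1 + 1))) (deriv (Lag k (i.1 + 1)))).det

open Polynomial in
theorem Lag_eq_eval_basis (k i : ℕ) (t : ℝ) :
    Lag k i t = (Lagrange.basis (Finset.range (k + 1)) (fun j : ℕ => (j : ℝ)) i).eval (k * t) := by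
  simp only [Lag, Lagrange.basis, Lagrange.basisDivisor, eval_prod, eval_mul, eval_C, eval_sub,
    eval_X]
  exact Finset.prod_congr rfl fun j _ => by rw [div_eq_inv_mul]

theorem sum_Lag (k : ℕ) (t : ℝ) : ∑ i ∈ Finset.range (k + 1), Lag k i t = 1 := by
  simp only [Lag_eq_eval_basis]
  rw [← Polynomial.eval_finsetSum, Lagrange.sum_basis Nat.cast_injective.injOn (by simp),
    Polynomial.eval_one]

theorem contDiff_Lag (k i : ℕ) : ContDiff ℝ 1 (Lag k i) := by
  unfold Lag
  fun_prop

theorem continuous_deriv_Lag (k i : ℕ) : Continuous (deriv (Lag k i)) :=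
  (contDiff_Lag k i).continuous_deriv le_rfl

theorem deriv_Lag_zero (k : ℕ) (t : ℝ) :
    deriv (Lag k 0) t = -∑ j : Fin k, deriv (Lag k (j.1 + 1)) t := by
  have h : ∑ i ∈ Finset.range (k + 1), deriv (Lag k i) t = 0 := by
    rw [← deriv_fun_sum fun i _ => ((contDiff_Lag k i).differentiable one_ne_zero) t]
    simp [sum_Lag]
  rw [Finset.sum_range_succ', Finset.sum_range] at h
  linarith

theorem ip_comm (φ ψ : ℝ → ℝ) : ip φ ψ = ip ψ φ := by
  simp only [ip, mul_comm]

theorem ip_deriv_Lag_zero (k : ℕ) {ψ : ℝ → ℝ} (hψ : Continuous ψ) :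
    ip (deriv (Lag k 0)) ψ = -∑ j : Fin k, ip (deriv (Lag k (j.1 + 1))) ψ := by
  simp only [ip, deriv_Lag_zero, neg_mul, Finset.sum_mul]
  rw [intervalIntegral.integral_neg, intervalIntegral.integral_finsetSum]
  exact fun j _ => ((continuous_deriv_Lag k _).mul hψ).intervalIntegrable _ _

section

variable {n R : Type*} [Fintype n] [DecidableEq n] [CommRing R]

theorem Matrix.det_one_sub_vecMulVec_single (z : R) (p : n) :
    (1 - vecMulVec (fun _ => z) (Pi.single p 1) : Matrix n n R).det = 1 - z := by
  have h := det_one_add_replicateCol_mul_replicateRow (ι := Unit) (fun _ : n => -z)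
    (Pi.single p 1)
  rw [single_one_dotProduct, ← vecMulVec_eq] at h
  rw [sub_eq_add_neg 1 z, ← h]
  congr 1
  ext i j
  simp [vecMulVec_apply, sub_eq_add_neg]

/-- Gluing an extra index to `p` with phase `z`: the extra row and column are those that make all
row and column sums of the bordered matrix vanish. -/
theorem Matrix.det_glue (B M : Matrix n n R) (p : n) (z w : R) (hzw : w * z = 1)
    (hM : ∀ i j, M i j = B i j + (if i = p ∧ j = p then ∑ a, ∑ b, B a b else 0)
      - z * (if j = p then ∑ b, B i b else 0) - w * (if i = p then ∑ a, B a j else 0)) :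
    M.det = B.det * (2 - z - w) := by
  have h : M = (1 - vecMulVec (fun _ => w) (Pi.single p 1))ᵀ * B *
      (1 - vecMulVec (fun _ => z) (Pi.single p 1)) := by
    ext i j
    rw [hM, transpose_sub, transpose_one, transpose_vecMulVec, sub_mul, one_mul, mul_sub, mul_one,
      sub_mul, mul_vecMulVec, vecMulVec_mul, vecMulVec_mul_vecMulVec]
    simp only [sub_apply, vecMulVec_apply, mulVec, vecMul, dotProduct, smul_eq_mul,
      Pi.single_apply, Pi.smul_apply]
    have hs : ∑ x, (∑ y, w * B y x) * z = ∑ a, ∑ b, B a b := by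
      rw [Finset.sum_comm (f := fun a b => B a b)]
      simp only [← Finset.mul_sum, ← Finset.sum_mul]
      rw [mul_right_comm, hzw, one_mul]
    rw [hs]
    simp only [← Finset.mul_sum, ← Finset.sum_mul]
    by_cases hi : i = p <;> by_cases hj : j = p <;> simp [hi, hj] <;> ring
  rw [h, det_mul, det_mul, det_transpose, det_one_sub_vecMulVec_single,
    det_one_sub_vecMulVec_single]
  linear_combination B.det * hzw

end

/-- For every `k ≥ 1` and every `θ ∈ ℝ`, `det(f_k(θ)) = d_k (2 - 2 cos θ)`. -/
theorem stmt0 (k : ℕ) (hk : 1 ≤ k) (θ : ℝ) :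
    (fSymb k θ).det = ((dk k * (2 - 2 * Real.cos θ) : ℝ) : ℂ) := by
  set B : Matrix (Fin k) (Fin k) ℝ := Matrix.of fun i j : Fin k =>
    ip (deriv (Lag k (j.1 + 1))) (deriv (Lag k (i.1 + 1))) with hB
  have hrow (i : Fin k) :
      ip (deriv (Lag k 0)) (deriv (Lag k (i.1 + 1))) = -∑ b, B i b :=
    ip_deriv_Lag_zero k (continuous_deriv_Lag k _)
  have hcol (j : Fin k) :
      ip (deriv (Lag k 0)) (deriv (Lag k (j.1 + 1))) = -∑ a, B a j := by
    rw [hrow]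
    simp only [hB, Matrix.of_apply, ip_comm (deriv (Lag k (j.1 + 1)))]
  have hcorner : ip (deriv (Lag k 0)) (deriv (Lag k 0)) = ∑ a, ∑ b, B a b := by
    rw [ip_deriv_Lag_zero k (continuous_deriv_Lag k _)]
    simp only [ip_comm _ (deriv (Lag k 0)), hrow, Finset.sum_neg_distrib, neg_neg]
  have hp (i : Fin k) : i.1 = k - 1 ↔ i = ⟨k - 1, by omega⟩ := by simp [Fin.ext_iff]
  rw [Matrix.det_glue (B.map (fun x => (x : ℂ))) _ ⟨k - 1, by omega⟩
    (Complex.exp (Complex.I * θ)) (Complex.exp (-(Complex.I * θ)))]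
  · have hd : (B.map (fun x => (x : ℂ))).det = (dk k : ℂ) :=
      (RingHom.map_det Complex.ofRealHom B).symm
    rw [hd]
    push_cast
    rw [Complex.cos]
    ring_nf
  · rw [← Complex.exp_add, neg_add_cancel, Complex.exp_zero]
  · intro i j
    simp only [fSymb, K0, K1, Matrix.add_apply, Matrix.smul_apply, Matrix.map_apply,
      Matrix.transpose_apply, Matrix.of_apply, smul_eq_mul, hp, hcorner]
    rw [hrow i, hcol j]
    have hBij : ip (deriv (Lag k (j.1 + 1))) (deriv (Lag k (i.1 + 1))) = B i j := rfl
    rw [hBij]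
    split_ifs <;> push_cast <;> ring
end

section
/- For every integer k ≥ 1, the determinant of the k×k matrix [⟨L_j', L_i'⟩]_{i,j=1}^{k} is strictly positive, and for every k ≥ 2 it equals the determinant of the (k−1)×(k−1) matrix [⟨L_j', L_i'⟩]_{i,j=1}^{k−1}. -/
open scoped BigOperators
open Matrix

/-- The `m×m` matrix whose `(i,j)` entry is `⟨L_j',L_i'⟩`, indices `1,…,m`. -/
noncomputable def gram (k m : ℕ) : Matrix (Fin m) (Fin m) ℝ :=
  Matrix.of fun i j => ip (deriv (Lag k (j.1 + 1))) (deriv (Lag k (i.1 + 1)))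

open Polynomial in
/-- The Dirichlet form `(p, q) ↦ ∫_0^1 p' q'` on real polynomials. -/
noncomputable def dirichletForm : ℝ[X] →ₗ[ℝ] ℝ[X] →ₗ[ℝ] ℝ :=
  LinearMap.mk₂ ℝ
    (fun p q => ∫ t in (0:ℝ)..1, (derivative p).eval t * (derivative q).eval t)
    (fun p₁ p₂ q => by
      simp only [derivative_add, eval_add, add_mul]
      exact intervalIntegral.integral_add
        (Continuous.intervalIntegrable (by fun_prop) _ _)
        (Continuous.intervalIntegrable (by fun_prop) _ _))
    (fun c p q => by simp [mul_assoc])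
    (fun p q₁ q₂ => by
      simp only [derivative_add, eval_add, mul_add]
      exact intervalIntegral.integral_add
        (Continuous.intervalIntegrable (by fun_prop) _ _)
        (Continuous.intervalIntegrable (by fun_prop) _ _))
    (fun c p q => by simp [mul_left_comm])

open Polynomial in
theorem dirichletForm_apply (p q : ℝ[X]) :
    dirichletForm p q = ∫ t in (0:ℝ)..1, (derivative p).eval t * (derivative q).eval t := rfl

theorem dirichletForm_comm (p q : Polynomial ℝ) : dirichletForm p q = dirichletForm q p := by
  simp only [dirichletForm_apply, mul_comm]

theorem dirichletForm_X_right (p : Polynomial ℝ) :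
    dirichletForm p Polynomial.X = p.eval 1 - p.eval 0 := by
  simp only [dirichletForm_apply, Polynomial.derivative_X, Polynomial.eval_one, mul_one]
  exact intervalIntegral.integral_eq_sub_of_hasDerivAt (fun t _ => p.hasDerivAt t)
    (Continuous.intervalIntegrable (by fun_prop) _ _)

theorem dirichletForm_self_pos {p : Polynomial ℝ} (hp : p.derivative ≠ 0) :
    0 < dirichletForm p p := by
  obtain ⟨c, hc, hpc⟩ : ∃ c ∈ Set.Icc (0:ℝ) 1, p.derivative.eval c ≠ 0 := by
    by_contra! h
    exact hp (Polynomial.eq_zero_of_infinite_isRoot _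
      ((Set.Icc_infinite (zero_lt_one' ℝ)).mono h))
  exact intervalIntegral.integral_pos zero_lt_one (by fun_prop)
    (fun t _ => mul_self_nonneg _) ⟨c, hc, mul_self_pos.mpr hpc⟩

/-- `Lag k i` as a polynomial. -/
noncomputable def lagPoly (k i : ℕ) : Polynomial ℝ :=
  Lagrange.basis (Finset.range (k + 1)) (fun j : ℕ => (j : ℝ) / k) i

theorem injOn_node {k : ℕ} (hk : k ≠ 0) (s : Set ℕ) :
    Set.InjOn (fun j : ℕ => (j : ℝ) / k) s := by
  intro a _ b _ h
  have : (k : ℝ) ≠ 0 := by exact_mod_cast hk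
  simpa [div_left_inj' this] using h

theorem Lag_eq_eval {k : ℕ} (hk : k ≠ 0) (i : ℕ) : Lag k i = fun t => (lagPoly k i).eval t := by
  have hk' : (k : ℝ) ≠ 0 := by exact_mod_cast hk
  funext t
  simp only [Lag, lagPoly, Lagrange.basis, Polynomial.eval_prod, Lagrange.basisDivisor,
    Polynomial.eval_mul, Polynomial.eval_C, Polynomial.eval_sub, Polynomial.eval_X]
  refine Finset.prod_congr rfl fun j hj => ?_
  have hij : (i : ℝ) - j ≠ 0 := by
    rw [sub_ne_zero]
    exact_mod_cast (Finset.ne_of_mem_erase hj).symm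
  rw [← sub_div]
  field_simp

theorem eval_lagPoly {k i j : ℕ} (hk : k ≠ 0) (hj : j ≤ k) :
    (lagPoly k i).eval ((j : ℝ) / k) = if i = j then 1 else 0 := by
  have hj' : j ∈ Finset.range (k + 1) := Finset.mem_range.mpr (by omega)
  split_ifs with h
  · subst h
    exact Lagrange.eval_basis_self (v := fun j : ℕ => (j : ℝ) / k) (injOn_node hk _) hj'
  · exact Lagrange.eval_basis_of_ne (v := fun j : ℕ => (j : ℝ) / k) h hj'

theorem sum_node_smul_lagPoly {k : ℕ} (hk : k ≠ 0) :
    ∑ i : Fin k, (((i.1 + 1 : ℕ) : ℝ) / k) • lagPoly k (i.1 + 1) = Polynomial.X := by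
  have h := Lagrange.eq_interpolate (s := Finset.range (k + 1)) (f := (Polynomial.X : Polynomial ℝ))
    (injOn_node hk _) (by
      rw [Polynomial.degree_X, Finset.card_range]
      exact_mod_cast (by omega : 1 < k + 1))
  rw [Lagrange.interpolate_apply, Finset.sum_range_succ'] at h
  rw [Fin.sum_univ_eq_sum_range
    (fun i => (((i + 1 : ℕ) : ℝ) / k) • lagPoly k (i + 1))]
  simpa [lagPoly, Polynomial.smul_eq_C_mul] using h.symm

theorem gram_apply {k : ℕ} (hk : k ≠ 0) (m : ℕ) (i j : Fin m) :
    _root_.gram k m i j = dirichletForm (lagPoly k (j.1 + 1)) (lagPoly k (i.1 + 1)) := by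
  simp [_root_.gram, ip, Lag_eq_eval hk, dirichletForm_apply]

theorem derivative_sum_smul_lagPoly_ne_zero {k : ℕ} (hk : k ≠ 0) {x : Fin k → ℝ} (hx : x ≠ 0) :
    (∑ i : Fin k, x i • lagPoly k (i.1 + 1)).derivative ≠ 0 := by
  intro h
  have hconst := Polynomial.eq_C_of_derivative_eq_zero h
  set p := ∑ i : Fin k, x i • lagPoly k (i.1 + 1) with hp
  have hval (j : ℕ) (hj : j ≤ k) :
      p.eval ((j : ℝ) / k) = ∑ i : Fin k, if i.1 + 1 = j then x i else 0 := by
    simp [hp, Polynomial.eval_finsetSum, eval_lagPoly hk hj]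
  apply hx
  funext i
  have h₀ : p.eval (((0 : ℕ) : ℝ) / k) = 0 := by
    rw [hval 0 (Nat.zero_le k)]
    simp
  have h₁ : p.eval (((i.1 + 1 : ℕ) : ℝ) / k) = x i := by
    rw [hval _ i.2]
    simp [← Fin.ext_iff]
  rw [hconst, Polynomial.eval_C] at h₀ h₁
  rw [← h₁, h₀, Pi.zero_apply]

theorem gram_posDef {k : ℕ} (hk : k ≠ 0) : (_root_.gram k k).PosDef := by
  refine Matrix.PosDef.of_dotProduct_mulVec_pos ?_ fun x hx => ?_
  · ext i j
    simp [gram_apply hk, dirichletForm_comm]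
  · have h := dirichletForm_self_pos (derivative_sum_smul_lagPoly_ne_zero hk hx)
    simpa [dotProduct, mulVec, gram_apply hk, map_sum, Finset.mul_sum, mul_comm,
      mul_left_comm, mul_assoc] using h

theorem sum_node_smul_gram {n : ℕ} :
    ∑ i : Fin (n + 1), (((i.1 + 1 : ℕ) : ℝ) / ((n + 1 : ℕ) : ℝ)) • _root_.gram (n + 1) (n + 1) i =
      Pi.single (Fin.last n) 1 := by
  have hk : n + 1 ≠ 0 := n.succ_ne_zero
  funext j
  have h : dirichletForm (lagPoly (n + 1) (j.1 + 1)) Polynomial.X =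
      if j.1 + 1 = n + 1 then 1 else 0 := by
    have h₁ := eval_lagPoly (i := j.1 + 1) hk le_rfl
    have h₀ := eval_lagPoly (i := j.1 + 1) hk (Nat.zero_le _)
    rw [div_self (by exact_mod_cast hk)] at h₁
    rw [Nat.cast_zero, zero_div, if_neg (by omega)] at h₀
    rw [dirichletForm_X_right, h₁, h₀, sub_zero]
  rw [← sum_node_smul_lagPoly hk, map_sum] at h
  simp only [map_smul] at h
  simp only [Finset.sum_apply, Pi.smul_apply, gram_apply hk, h, Pi.single_apply, Fin.ext_iff,
    Fin.val_last, Nat.add_right_cancel_iff]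

theorem det_gram_succ (n : ℕ) : (_root_.gram (n + 1) (n + 1)).det = (_root_.gram (n + 1) n).det := by
  have hlast : (((Fin.last n).1 + 1 : ℕ) : ℝ) / ((n + 1 : ℕ) : ℝ) = 1 :=
    div_self (by exact_mod_cast n.succ_ne_zero)
  have h := det_updateRow_sum (_root_.gram (n + 1) (n + 1)) (Fin.last n)
    (fun i => ((i.1 + 1 : ℕ) : ℝ) / ((n + 1 : ℕ) : ℝ))
  rw [sum_node_smul_gram, hlast, one_smul, ← adjugate_apply, adjugate_fin_succ_eq_det_submatrix,
    Even.neg_one_pow (Even.add_self _), one_mul] at h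
  rw [← h]
  congr 1
  ext i j
  simp [_root_.gram]

/-- For every `k ≥ 1` the determinant of `[⟨L_j',L_i'⟩]_{i,j=1}^k` is strictly positive, and
for `k ≥ 2` it equals the determinant of `[⟨L_j',L_i'⟩]_{i,j=1}^{k-1}`. -/
theorem stmt1 (k : ℕ) (hk : 1 ≤ k) :
    0 < (gram k k).det ∧ (2 ≤ k → (gram k k).det = (gram k (k - 1)).det) := by
  obtain ⟨n, rfl⟩ : ∃ n, k = n + 1 := ⟨k - 1, by omega⟩
  exact ⟨(gram_posDef n.succ_ne_zero).det_pos, fun _ => det_gram_succ n⟩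
end

section
/- For all θ1, θ2 ∈ ℝ, det(f_{P2}(θ1,θ2)) = (4096/81)·(−2cos θ1 − 2cos θ2 − cos θ1 cos θ2 + 5). -/
open Matrix Complex

/-- The `4×4` Hermitian matrix-valued symbol `f_{P2}` of the `ℙ₂` Finite Element
stiffness matrices, with `α = 16/3`, `β = 4/3`, `γ = 4`. -/
noncomputable def fP2 (θ1 θ2 : ℝ) : Matrix (Fin 4) (Fin 4) ℂ :=
  let α : ℂ := 16 / 3
  let β : ℂ := 4 / 3
  let γ : ℂ := 4
  !![α, -β * (1 + Complex.exp (Complex.I * θ1)), -β * (1 + Complex.exp (Complex.I * θ2)), 0;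
     -β * (1 + Complex.exp (-(Complex.I * θ1))), α, 0, -β * (1 + Complex.exp (Complex.I * θ2));
     -β * (1 + Complex.exp (-(Complex.I * θ2))), 0, α, -β * (1 + Complex.exp (Complex.I * θ1));
     0, -β * (1 + Complex.exp (-(Complex.I * θ2))), -β * (1 + Complex.exp (-(Complex.I * θ1))),
       γ + (β / 2) * ((Real.cos θ1 + Real.cos θ2 : ℝ) : ℂ)]

/-- `det(f_{P2}(θ1,θ2)) = (4096/81)(−2cos θ1 − 2cos θ2 − cos θ1 cos θ2 + 5)`. -/
theorem stmt3 (θ1 θ2 : ℝ) :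
    (fP2 θ1 θ2).det =
      (((4096 / 81 : ℝ) *
        (-2 * Real.cos θ1 - 2 * Real.cos θ2 - Real.cos θ1 * Real.cos θ2 + 5) : ℝ) : ℂ) := by
  have exp_mul_exp_neg (z : ℂ) : exp z * exp (-z) = 1 := by
    rw [← Complex.exp_add, add_neg_cancel, Complex.exp_zero]
  have cos_eq (θ : ℝ) :
      Complex.cos θ = (exp (I * θ) + exp (-(I * θ))) / 2 := by
    rw [Complex.cos, neg_mul, mul_comm (θ : ℂ) I]
  have h₁ := exp_mul_exp_neg (I * θ1)
  have h₂ := exp_mul_exp_neg (I * θ2)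
  push_cast
  simp only [fP2, det_succ_row_zero, Fin.sum_univ_succ]
  simp [Fin.succAbove, cos_eq]
  generalize exp (I * θ1) = x at *
  generalize exp (-(I * θ1)) = x' at *
  generalize exp (I * θ2) = y at *
  generalize exp (-(I * θ2)) = y' at *
  grind
end

section
/- With C' = 4096/81, for all θ1, θ2 ∈ ℝ one has C'·((2−2cos θ1) + (2−2cos θ2)) ≤ det(f_{P2}(θ1,θ2)) ≤ (3C'/2)·((2−2cos θ1) + (2−2cos θ2)). -/
open Matrix Complex

open scoped ComplexOrder

/-- The determinant of the symbol as a real polynomial in the two cosines. -/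
theorem det_fP2 (θ1 θ2 : ℝ) :
    (fP2 θ1 θ2).det = ((4096 / 81 * (5 - 2 * (Real.cos θ1 + Real.cos θ2)
      - Real.cos θ1 * Real.cos θ2) : ℝ) : ℂ) := by
  have exp_mul_neg (θ : ℝ) : Complex.exp (Complex.I * θ) * Complex.exp (-(Complex.I * θ)) = 1 := by
    rw [← Complex.exp_add, add_neg_cancel, Complex.exp_zero]
  have cos_eq (θ : ℝ) : Complex.cos θ =
      (Complex.exp (Complex.I * θ) + Complex.exp (-(Complex.I * θ))) / 2 := by
    rw [Complex.cos, mul_comm (θ : ℂ), neg_mul, mul_comm (θ : ℂ)]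
  have h1 := exp_mul_neg θ1
  have h2 := exp_mul_neg θ2
  push_cast
  simp only [fP2, Complex.ofReal_add, Complex.ofReal_cos, cos_eq]
  generalize Complex.exp (Complex.I * θ1) = z at *
  generalize Complex.exp (-(Complex.I * θ1)) = z' at *
  generalize Complex.exp (Complex.I * θ2) = w at *
  generalize Complex.exp (-(Complex.I * θ2)) = w' at *
  simp [Matrix.det_succ_row_zero, Fin.sum_univ_succ, Fin.succAbove]
  grind

/-- With `C' = 4096/81`, for all `θ1, θ2`:
`C'((2−2cos θ1)+(2−2cos θ2)) ≤ det f_{P2}(θ1,θ2) ≤ (3C'/2)((2−2cos θ1)+(2−2cos θ2))`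
(the inequalities are in the complex order, which in particular asserts that the
determinant is real). -/
theorem stmt4 (θ1 θ2 : ℝ) :
    (((4096 / 81 : ℝ) * ((2 - 2 * Real.cos θ1) + (2 - 2 * Real.cos θ2)) : ℝ) : ℂ) ≤
        (fP2 θ1 θ2).det ∧
      (fP2 θ1 θ2).det ≤
        (((3 * (4096 / 81 : ℝ) / 2) * ((2 - 2 * Real.cos θ1) + (2 - 2 * Real.cos θ2)) : ℝ) : ℂ) := by
  have hx := Real.cos_le_one θ1
  have hy := Real.cos_le_one θ2
  have hx' := Real.neg_one_le_cos θ1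
  have hy' := Real.neg_one_le_cos θ2
  rw [det_fP2, Complex.real_le_real, Complex.real_le_real]
  constructor
  · nlinarith [mul_nonneg (sub_nonneg.2 hx) (neg_le_iff_add_nonneg.1 hy'),
      mul_nonneg (neg_le_iff_add_nonneg.1 hx') (sub_nonneg.2 hy)]
  · nlinarith [mul_nonneg (sub_nonneg.2 hx) (sub_nonneg.2 hy)]
end

section
/- There exist constants C1, C2 > 0 such that for all θ1, θ2 ∈ ℝ, the smallest eigenvalue λ_min of the Hermitian matrix f_{P2}(θ1,θ2) satisfies C1·((2−2cos θ1) + (2−2cos θ2)) ≤ λ_min ≤ C2·((2−2cos θ1) + (2−2cos θ2)). -/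
open Matrix Complex

open scoped ComplexOrder in
/-- Any lower bound for the eigenvalues of a Hermitian matrix bounds its quadratic form. -/
theorem Matrix.IsHermitian.mul_le_re_dotProduct_mulVec {n : Type*} [Fintype n] [DecidableEq n]
    {A : Matrix n n ℂ} (hA : A.IsHermitian) {c : ℝ} (hc : ∀ i, c ≤ hA.eigenvalues i) (x : n → ℂ) :
    c * (star x ⬝ᵥ x).re ≤ (star x ⬝ᵥ A *ᵥ x).re := by
  have hpsd : (A - algebraMap ℂ (Matrix n n ℂ) c).PosSemidef := by
    rw [posSemidef_iff_isHermitian_and_spectrum_nonneg]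
    refine ⟨hA.sub ?_, ?_⟩
    · rw [algebraMap_eq_diagonal]
      exact isHermitian_diagonal_of_self_adjoint _ (by ext; simp)
    · rw [← spectrum.sub_singleton_eq, hA.spectrum_eq_image_range]
      rintro _ ⟨_, ⟨_, ⟨i, rfl⟩, rfl⟩, _, rfl, rfl⟩
      simpa using hc i
  have := (Complex.le_def.mp (hpsd.dotProduct_mulVec_nonneg x)).1
  rw [Algebra.algebraMap_eq_smul_one, sub_mulVec, smul_mulVec, one_mulVec, dotProduct_sub,
    dotProduct_smul] at this
  simpa using this

/-- The eigenvalue equation of `fP2`, with `u = 1 + e^{iθ1}` and `w = 1 + e^{iθ2}`,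
forces a quartic relation on the shifted eigenvalue `μ`. -/
theorem quartic_of_eigenvector {u w u' w' μ t x y z v : ℂ} (hμ : μ ≠ 0)
    (h1 : μ * x = u * y + w * z) (h2 : μ * y = u' * x + w * v)
    (h3 : μ * z = w' * x + u * v) (h4 : (μ - t) * v = w' * y + u' * z)
    (hne : ¬(x = 0 ∧ y = 0 ∧ z = 0 ∧ v = 0)) :
    (μ ^ 2 - (u * u' + w * w')) * (μ * (μ - t) - (u * u' + w * w'))
      = 4 * (u * u') * (w * w') := by
  have e1 : (μ ^ 2 - (u * u' + w * w')) * x = 2 * u * w * v := by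
    linear_combination μ * h1 + u * h2 + w * h3
  have e4 : (μ * (μ - t) - (u * u' + w * w')) * v = 2 * u' * w' * x := by
    linear_combination μ * h4 + w' * h2 + u' * h3
  by_cases hx : x = 0
  · by_cases hv : v = 0
    · subst hx hv
      have hy : y = 0 := by simpa [hμ] using h2
      have hz : z = 0 := by simpa [hμ] using h3
      exact absurd ⟨rfl, hy, hz, rfl⟩ hne
    · apply mul_right_cancel₀ hv
      linear_combination (μ ^ 2 - (u * u' + w * w')) * e4 + 2 * u' * w' * e1
  · apply mul_right_cancel₀ hx
    linear_combination (μ * (μ - t) - (u * u' + w * w')) * e1 + 2 * u * w * e4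

/-- Small shifts cannot solve the characteristic relation of the symbol. -/
theorem quarter_le_of_quartic {l p q : ℝ} (hp : p ≤ 1) (hp' : -1 ≤ p) (hq : q ≤ 1) (hq' : -1 ≤ q)
    (h : ((4 - l) ^ 2 - (2 + 2 * p + (2 + 2 * q))) *
      ((4 - l) * ((4 - l) - (1 - (p + q) / 2)) - (2 + 2 * p + (2 + 2 * q)))
        = 4 * (2 + 2 * p) * (2 + 2 * q)) :
    (1 - (p + q) / 2) / 4 ≤ l := by
  by_contra! hl
  obtain ⟨t, ht⟩ : ∃ t, t = 1 - (p + q) / 2 := ⟨_, rfl⟩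
  have h0 : 0 ≤ t := by linarith
  have h2 : t ≤ 2 := by linarith
  obtain ⟨d, hd⟩ : ∃ d, d = t / 4 - l := ⟨_, rfl⟩
  have hd0 : 0 < d := by linarith
  have hs : 2 + 2 * p + (2 + 2 * q) = 8 - 4 * t := by linarith
  have hA : 8 + 2 * t + d ≤ (4 - l) ^ 2 - (8 - 4 * t) := by
    have : l = t / 4 - d := by linarith
    subst this
    nlinarith
  have hB : 8 - 2 * t + d ≤ (4 - l) * ((4 - l) - t) - (8 - 4 * t) := by
    have : l = t / 4 - d := by linarith
    subst this
    nlinarith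
  have hC : 4 * (2 + 2 * p) * (2 + 2 * q) ≤ (8 - 4 * t) ^ 2 := by
    rw [← hs]; nlinarith [sq_nonneg (p - q)]
  rw [hs, ← ht] at h
  have hAB := mul_le_mul hA hB (by linarith) (by linarith)
  nlinarith

/-- Every eigenvalue of the symbol is at least `1/12` of the Laplacian symbol. -/
theorem fP2_eigenvalue_lower_bound {θ1 θ2 l : ℝ} {x : Fin 4 → ℂ} (hx : x ≠ 0)
    (h : fP2 θ1 θ2 *ᵥ x = (l : ℂ) • x) :
    (1 / 12) * ((2 - 2 * Real.cos θ1) + (2 - 2 * Real.cos θ2)) ≤ l := by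
  have hprod (θ : ℝ) : (1 + exp (I * θ)) * (1 + exp (-(I * θ))) = 2 + 2 * (Real.cos θ : ℂ) := by
    have h1 : exp (I * θ) * exp (-(I * θ)) = 1 := by rw [← exp_add]; simp
    have h2 : 2 * (Real.cos θ : ℂ) = exp (I * θ) + exp (-(I * θ)) := by
      rw [ofReal_cos, two_cos]
      ring_nf
    linear_combination h1 - h2
  have hc (i : Fin 4) := congrFun h i
  have c1 := hc 0
  have c2 := hc 1
  have c3 := hc 2
  have c4 := hc 3
  simp [fP2, mulVec, dotProduct, Fin.sum_univ_four] at c1 c2 c3 c4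
  have b1 := Real.cos_le_one θ1
  have b2 := Real.neg_one_le_cos θ1
  have b3 := Real.cos_le_one θ2
  have b4 := Real.neg_one_le_cos θ2
  by_cases hμ : 4 - 3 / 4 * l = 0
  · linarith
  have key := quartic_of_eigenvector (u := 1 + exp (I * θ1)) (w := 1 + exp (I * θ2))
    (u' := 1 + exp (-(I * θ1))) (w' := 1 + exp (-(I * θ2))) (μ := ((4 - 3 / 4 * l : ℝ) : ℂ))
    (t := ((1 - (Real.cos θ1 + Real.cos θ2) / 2 : ℝ) : ℂ)) (x := x 0) (y := x 1) (z := x 2) (v := x 3)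
    (by exact_mod_cast hμ)
    (by push_cast; linear_combination (3 / 4) * c1) (by push_cast; linear_combination (3 / 4) * c2)
    (by push_cast; linear_combination (3 / 4) * c3) (by push_cast; linear_combination (3 / 4) * c4)
    (fun h0 => hx (by ext i; fin_cases i <;> simp [h0]))
  rw [hprod, hprod] at key
  have := quarter_le_of_quartic (l := 3 / 4 * l) b1 b2 b3 b4 (by exact_mod_cast key)
  linarith

/-- The quadratic form of the symbol at the constant vector. -/
theorem re_dotProduct_fP2_mulVec_one (θ1 θ2 : ℝ) :
    (star 1 ⬝ᵥ fP2 θ1 θ2 *ᵥ 1).re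
      = 7 / 3 * ((2 - 2 * Real.cos θ1) + (2 - 2 * Real.cos θ2)) := by
  have he (θ : ℝ) : (exp (I * θ)).re = Real.cos θ := by rw [mul_comm, exp_ofReal_mul_I_re]
  have he' (θ : ℝ) : (exp (-(I * θ))).re = Real.cos θ := by
    simpa using he (-θ)
  have hc (θ : ℝ) : (cos (θ : ℂ)).re = Real.cos θ := by rw [← ofReal_cos, ofReal_re]
  have h43 : ((4 : ℂ) / 3) = ((4 / 3 : ℝ) : ℂ) := by push_cast; rfl
  simp only [fP2, h43]
  simp [mulVec, dotProduct, Fin.sum_univ_four, he, he', hc]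
  ring

/-- There exist constants `C1, C2 > 0` such that for all `θ1, θ2`, the smallest eigenvalue
of the Hermitian matrix `f_{P2}(θ1,θ2)` is between `C1((2−2cos θ1)+(2−2cos θ2))` and
`C2((2−2cos θ1)+(2−2cos θ2))`. -/
theorem stmt5 :
    ∃ C1 C2 : ℝ, 0 < C1 ∧ 0 < C2 ∧
      ∀ (θ1 θ2 : ℝ) (h : (fP2 θ1 θ2).IsHermitian),
        C1 * ((2 - 2 * Real.cos θ1) + (2 - 2 * Real.cos θ2)) ≤ ⨅ i, h.eigenvalues i ∧
        (⨅ i, h.eigenvalues i) ≤ C2 * ((2 - 2 * Real.cos θ1) + (2 - 2 * Real.cos θ2)) := by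
  refine ⟨1 / 12, 7 / 12, by norm_num, by norm_num, fun θ1 θ2 h => ⟨le_ciInf fun i => ?_, ?_⟩⟩
  · refine fP2_eigenvalue_lower_bound (x := h.eigenvectorBasis i) ?_ ?_
    · intro h0
      exact h.eigenvectorBasis.toBasis.ne_zero i (by ext j; simpa using congrFun h0 j)
    · simpa using h.mulVec_eigenvectorBasis i
  · have hle := h.mul_le_re_dotProduct_mulVec
      (fun i => ciInf_le (Set.finite_range h.eigenvalues).bddBelow i) 1
    rw [re_dotProduct_fP2_mulVec_one] at hle
    simp at hle
    linarith
end

section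
/- There exist constants m, M with 0 < m ≤ M such that for all θ1, θ2 ∈ ℝ, if λ_1 ≤ λ_2 ≤ λ_3 ≤ λ_4 denote the eigenvalues of the Hermitian matrix f_{P2}(θ1,θ2) in nondecreasing order, then m ≤ λ_j ≤ M for j = 2, 3, 4; equivalently, at most one eigenvalue of f_{P2}(θ1,θ2) is smaller than m, and all eigenvalues are at most M. -/
open Matrix Complex

/-- If the quadratic form of a Hermitian matrix is bounded below by `m` on the hyperplane
`v k = 0`, then at most one eigenvalue is smaller than `m`. -/
lemma Matrix.IsHermitian.ncard_eigenvalues_lt_le_one {n : Type*} [Fintype n] [DecidableEq n]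
    {A : Matrix n n ℂ} (h : A.IsHermitian) (k : n) (m : ℝ)
    (hA : ∀ v : n → ℂ, v k = 0 → m * (star v ⬝ᵥ v).re ≤ (star v ⬝ᵥ A *ᵥ v).re) :
    {i : n | h.eigenvalues i < m}.ncard ≤ 1 := by
  rw [Set.ncard_le_one]
  intro i hi j hj
  simp only [Set.mem_ofPred_eq] at hi hj
  by_contra hij
  have horth (a b : n) : star (h.eigenvectorBasis a).ofLp ⬝ᵥ (h.eigenvectorBasis b).ofLp =
      if a = b then 1 else 0 := by
    have := orthonormal_iff_ite.mp h.eigenvectorBasis.orthonormal a b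
    rwa [EuclideanSpace.inner_eq_star_dotProduct, dotProduct_comm] at this
  obtain ⟨c, d, hcd, hk⟩ : ∃ c d : ℂ, 0 < normSq c + normSq d ∧
      c * h.eigenvectorBasis i k + d * h.eigenvectorBasis j k = 0 := by
    by_cases hu : h.eigenvectorBasis i k = 0
    · exact ⟨1, 0, by simp, by simp [hu]⟩
    · exact ⟨h.eigenvectorBasis j k, -h.eigenvectorBasis i k,
        add_pos_of_nonneg_of_pos (normSq_nonneg _) (normSq_pos.mpr (neg_ne_zero.mpr hu)), by ring⟩
  have key := hA (c • (h.eigenvectorBasis i).ofLp + d • (h.eigenvectorBasis j).ofLp)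
    (by simpa using hk)
  simp only [mulVec_add, mulVec_smul, h.mulVec_eigenvectorBasis, star_add, star_smul,
    add_dotProduct, dotProduct_add, smul_dotProduct, dotProduct_smul, horth, if_neg hij,
    if_neg (Ne.symm hij), if_true] at key
  simp [normSq_apply] at key hcd
  have hc := add_nonneg (mul_self_nonneg c.re) (mul_self_nonneg c.im)
  have hd := add_nonneg (mul_self_nonneg d.re) (mul_self_nonneg d.im)
  rcases le_total (h.eigenvalues i) (h.eigenvalues j) with hle | hle
  · linarith [mul_pos (sub_pos.mpr hj) hcd, mul_nonneg (sub_nonneg.mpr hle) hc]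
  · linarith [mul_pos (sub_pos.mpr hi) hcd, mul_nonneg (sub_nonneg.mpr hle) hd]

lemma norm_one_add_exp_I_mul_le (θ : ℝ) : ‖1 + exp (I * θ)‖ ≤ 2 := by
  refine (norm_add_le _ _).trans ?_
  rw [mul_comm, norm_exp_ofReal_mul_I]
  norm_num

lemma norm_one_add_exp_neg_I_mul_le (θ : ℝ) : ‖1 + exp (-(I * θ))‖ ≤ 2 := by
  simpa using norm_one_add_exp_I_mul_le (-θ)

lemma fP2_quadratic_form_lower_bound (θ1 θ2 : ℝ) (v : Fin 4 → ℂ) (hv : v 3 = 0) :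
    1 * (star v ⬝ᵥ v).re ≤ (star v ⬝ᵥ fP2 θ1 θ2 *ᵥ v).re := by
  have offdiag (p x y : ℂ) (hp : ‖p‖ ≤ 2) : (star x * (p * y)).re ≤ 2 * (‖x‖ * ‖y‖) := by
    refine (re_le_norm _).trans ?_
    rw [norm_mul, norm_mul, norm_star]
    nlinarith [mul_nonneg (norm_nonneg x) (norm_nonneg y)]
  have diag (x : ℂ) : (star x * x).re = ‖x‖ ^ 2 := by
    rw [← normSq_eq_norm_sq, normSq_apply]
    simp
  have h1 := offdiag _ (v 0) (v 1) (norm_one_add_exp_I_mul_le θ1)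
  have h2 := offdiag _ (v 0) (v 2) (norm_one_add_exp_I_mul_le θ2)
  have h3 := offdiag _ (v 1) (v 0) (norm_one_add_exp_neg_I_mul_le θ1)
  have h4 := offdiag _ (v 2) (v 0) (norm_one_add_exp_neg_I_mul_le θ2)
  have hnorm : star v ⬝ᵥ v = star (v 0) * v 0 + star (v 1) * v 1 + star (v 2) * v 2 := by
    simp [dotProduct, Fin.sum_univ_four, hv]
  have hform : star v ⬝ᵥ fP2 θ1 θ2 *ᵥ v =
      ((16 / 3 : ℝ) : ℂ) * (star (v 0) * v 0 + star (v 1) * v 1 + star (v 2) * v 2)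
      - ((4 / 3 : ℝ) : ℂ) * (star (v 0) * ((1 + exp (I * θ1)) * v 1)
        + star (v 0) * ((1 + exp (I * θ2)) * v 2)
        + star (v 1) * ((1 + exp (-(I * θ1))) * v 0)
        + star (v 2) * ((1 + exp (-(I * θ2))) * v 0)) := by
    simp [dotProduct, mulVec, Fin.sum_univ_four, hv, fP2]
    ring
  rw [hform, hnorm, sub_re, re_ofReal_mul, re_ofReal_mul]
  simp only [add_re, diag]
  nlinarith [sq_nonneg (‖v 0‖ - ‖v 1‖), sq_nonneg (‖v 0‖ - ‖v 2‖),
    sq_nonneg (13 * ‖v 0‖ - 16 * ‖v 1‖), sq_nonneg (13 * ‖v 0‖ - 16 * ‖v 2‖),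
    sq_nonneg (‖v 1‖), sq_nonneg (‖v 2‖)]

lemma norm_fP2_apply_le (θ1 θ2 : ℝ) (i j : Fin 4) : ‖fP2 θ1 θ2 i j‖ ≤ 6 := by
  have h1 := norm_one_add_exp_I_mul_le θ1
  have h2 := norm_one_add_exp_I_mul_le θ2
  have h3 := norm_one_add_exp_neg_I_mul_le θ1
  have h4 := norm_one_add_exp_neg_I_mul_le θ2
  have h5 : ‖(4 : ℂ) + 4 / 3 / 2 * (cos θ1 + cos θ2)‖ ≤ 6 := by
    have : (4 : ℂ) + 4 / 3 / 2 * (cos θ1 + cos θ2) =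
        ((4 + 2 / 3 * (Real.cos θ1 + Real.cos θ2) : ℝ) : ℂ) := by
      push_cast
      ring
    rw [this, norm_real, Real.norm_eq_abs, abs_le]
    constructor <;> linarith [Real.neg_one_le_cos θ1, Real.neg_one_le_cos θ2,
      Real.cos_le_one θ1, Real.cos_le_one θ2]
  fin_cases i <;> fin_cases j <;> simp [fP2, -neg_add_rev] <;> linarith

/-- The eigenvalues of a Hermitian matrix are bounded by its size times a bound on its entries. -/
lemma Matrix.IsHermitian.eigenvalues_le_card_mul {n : Type*} [Fintype n] [DecidableEq n]
    {A : Matrix n n ℂ} (h : A.IsHermitian) {C : ℝ} (hC : ∀ i j, ‖A i j‖ ≤ C) (i : n) :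
    h.eigenvalues i ≤ Fintype.card n * C := by
  have hev : Module.End.HasEigenvalue (Matrix.toLin' A) (h.eigenvalues i : ℂ) := by
    refine Module.End.hasEigenvalue_of_hasEigenvector (x := (h.eigenvectorBasis i).ofLp) ?_
    refine Module.End.hasEigenvector_iff.mpr ⟨Module.End.mem_eigenspace_iff.mpr ?_, ?_⟩
    · rw [toLin'_apply, h.mulVec_eigenvectorBasis]
      rfl
    · intro h0
      exact h.eigenvectorBasis.orthonormal.ne_zero i (by ext j; exact congrFun h0 j)
  obtain ⟨k, hk⟩ := eigenvalue_mem_ball hev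
  rw [mem_closedBall_iff_norm] at hk
  calc h.eigenvalues i ≤ ‖(h.eigenvalues i : ℂ)‖ := by
        rw [norm_real]
        exact Real.le_norm_self _
    _ ≤ ‖A k k‖ + ∑ j ∈ Finset.univ.erase k, ‖A k j‖ := by
        linarith [norm_le_norm_add_norm_sub' (h.eigenvalues i : ℂ) (A k k)]
    _ = ∑ j, ‖A k j‖ := Finset.add_sum_erase _ (fun j ↦ ‖A k j‖) (Finset.mem_univ k)
    _ ≤ ∑ _j : n, C := Finset.sum_le_sum fun j _ ↦ hC k j
    _ = Fintype.card n * C := by simp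

/-- There exist constants `0 < m ≤ M` such that for all `θ1, θ2`, at most one eigenvalue of
the Hermitian matrix `f_{P2}(θ1,θ2)` is smaller than `m` (so the three largest eigenvalues
lie in `[m, M]`), and all eigenvalues are at most `M`. -/
theorem stmt6 :
    ∃ m M : ℝ, 0 < m ∧ m ≤ M ∧
      ∀ (θ1 θ2 : ℝ) (h : (fP2 θ1 θ2).IsHermitian),
        ({i : Fin 4 | h.eigenvalues i < m}.ncard ≤ 1) ∧ ∀ i, h.eigenvalues i ≤ M := by
  refine ⟨1, 24, by norm_num, by norm_num, fun θ1 θ2 h ↦ ⟨?_, fun i ↦ ?_⟩⟩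
  · exact h.ncard_eigenvalues_lt_le_one 3 1 (fP2_quadratic_form_lower_bound θ1 θ2)
  · have := h.eigenvalues_le_card_mul (norm_fP2_apply_le θ1 θ2) i
    norm_num at this
    exact this
end

section
/- For all θ1, θ2 ∈ ℝ, the trigonometric polynomial h(θ1,θ2) = −cos θ2 cos²θ1 − cos θ1 cos²θ2 + 4cos²θ1 + 4cos²θ2 − 80 cos θ1 cos θ2 + 74 is nonnegative: h(θ1,θ2) ≥ 0. -/
/-- The trigonometric polynomial
`h(θ1,θ2) = −cos θ2 cos²θ1 − cos θ1 cos²θ2 + 4cos²θ1 + 4cos²θ2 − 80 cos θ1 cos θ2 + 74`. -/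
noncomputable def hP3 (θ1 θ2 : ℝ) : ℝ :=
  -Real.cos θ2 * (Real.cos θ1) ^ 2 - Real.cos θ1 * (Real.cos θ2) ^ 2 +
    4 * (Real.cos θ1) ^ 2 + 4 * (Real.cos θ2) ^ 2 - 80 * Real.cos θ1 * Real.cos θ2 + 74

/-- `h(θ1,θ2) ≥ 0` for all `θ1, θ2 ∈ ℝ`. -/
theorem stmt7 (θ1 θ2 : ℝ) : 0 ≤ hP3 θ1 θ2 := by
  have hx := Real.cos_le_one θ1
  have hx' := Real.neg_one_le_cos θ1
  have hy := Real.cos_le_one θ2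
  have hy' := Real.neg_one_le_cos θ2
  unfold hP3
  generalize Real.cos θ1 = x at *
  generalize Real.cos θ2 = y at *
  have h₁ : 0 ≤ (x + y + 88) * (x - y) ^ 2 := mul_nonneg (by linarith) (sq_nonneg _)
  have h₂ : 0 ≤ (2 - (x + y)) * ((x + y) ^ 2 + 74 * (x + y + 2)) :=
    mul_nonneg (by linarith) (add_nonneg (sq_nonneg _) (by linarith))
  linarith
end

section
/- For all θ1, θ2 ∈ ℝ, h(θ1,θ2) ≤ (81/2)·((2−2cos θ1) + (2−2cos θ2)). -/
/-- The left-hand side is concave in `x`, and the certificate interpolates it from `x = ±1`. -/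
theorem cubic_nonneg_of_mem_Icc {x y : ℝ} (hx : x ∈ Set.Icc (-1) 1) (hy : y ∈ Set.Icc (-1) 1) :
    0 ≤ 88 - 81 * (x + y) + x * y * (x + y) - 4 * (x ^ 2 + y ^ 2) + 80 * x * y := by
  obtain ⟨hx₁, hx₂⟩ := hx
  obtain ⟨hy₁, hy₂⟩ := hy
  have key : 88 - 81 * (x + y) + x * y * (x + y) - 4 * (x ^ 2 + y ^ 2) + 80 * x * y =
      (4 - y) * ((1 - x) * (1 + x)) + 3 / 2 * ((1 + x) * ((1 - y) * (1 + y))) +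
        5 / 2 * ((1 - x) * ((1 - y) * (33 + y))) := by
    ring
  have h₁ : 0 ≤ 1 - x := by linarith
  have h₂ : 0 ≤ 1 + x := by linarith
  have h₃ : 0 ≤ 1 - y := by linarith
  have h₄ : 0 ≤ 1 + y := by linarith
  have h₅ : 0 ≤ 4 - y := by linarith
  have h₆ : 0 ≤ 33 + y := by linarith
  rw [key]
  positivity

/-- `h(θ1,θ2) ≤ (81/2)((2−2cos θ1) + (2−2cos θ2))` for all `θ1, θ2 ∈ ℝ`. -/
theorem stmt8 (θ1 θ2 : ℝ) :
    hP3 θ1 θ2 ≤ (81 / 2) * ((2 - 2 * Real.cos θ1) + (2 - 2 * Real.cos θ2)) := by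
  have h := cubic_nonneg_of_mem_Icc (Real.cos_mem_Icc θ1) (Real.cos_mem_Icc θ2)
  unfold hP3
  linarith
end

section
/- Let a = 205891132094649/81920000000 and define D(θ1,θ2) = a·(−cos θ2 cos²θ1 − cos θ1 cos²θ2 + 4cos²θ1 + 4cos²θ2 − 80 cos θ1 cos θ2 − 195 cos θ1 − 195 cos θ2 + 464). Then for all θ1, θ2 ∈ ℝ, (195a/2)·((2−2cos θ1) + (2−2cos θ2)) ≤ D(θ1,θ2) ≤ 138a·((2−2cos θ1) + (2−2cos θ2)). -/
/-- The determinant of the `9×9` symbol of the `ℙ₃` Finite Element stiffness matrices,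
as an explicit trigonometric polynomial, with `a = 205891132094649/81920000000`. -/
noncomputable def DP3 (θ1 θ2 : ℝ) : ℝ :=
  (205891132094649 / 81920000000 : ℝ) *
    (-Real.cos θ2 * (Real.cos θ1) ^ 2 - Real.cos θ1 * (Real.cos θ2) ^ 2 +
      4 * (Real.cos θ1) ^ 2 + 4 * (Real.cos θ2) ^ 2 - 80 * Real.cos θ1 * Real.cos θ2 -
      195 * Real.cos θ1 - 195 * Real.cos θ2 + 464)

/-- The cubic factor of `DP3`, in the variables `x = cos θ1` and `y = cos θ2`, is bounded below
on the square `[-1, 1]²`. -/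
theorem cubic_lower_bound {x y : ℝ} (hx : -1 ≤ x) (hx' : x ≤ 1) (hy : -1 ≤ y) (hy' : y ≤ 1) :
    195 / 2 * ((2 - 2 * x) + (2 - 2 * y)) ≤
      -y * x ^ 2 - x * y ^ 2 + 4 * x ^ 2 + 4 * y ^ 2 - 80 * x * y - 195 * x - 195 * y + 464 := by
  have hdiag : 0 ≤ (2 - (x + y)) * ((x + y) ^ 2 + 74 * (x + y) + 148) :=
    mul_nonneg (by linarith) (by nlinarith [sq_nonneg (x + y)])
  have hoff : 0 ≤ (x + y + 88) * (x - y) ^ 2 := mul_nonneg (by linarith) (sq_nonneg _)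
  linarith

/-- The cubic factor of `DP3`, in the variables `x = cos θ1` and `y = cos θ2`, is bounded above
on the square `[-1, 1]²`. -/
theorem cubic_upper_bound {x y : ℝ} (hx : -1 ≤ x) (hx' : x ≤ 1) (hy : -1 ≤ y) (hy' : y ≤ 1) :
    -y * x ^ 2 - x * y ^ 2 + 4 * x ^ 2 + 4 * y ^ 2 - 80 * x * y - 195 * x - 195 * y + 464 ≤
      138 * ((2 - 2 * x) + (2 - 2 * y)) := by
  have hs : 0 ≤ x + y + 88 := by linarith
  rcases le_total 0 (x + y) with h | h
  · have hcorner : 0 ≤ (x + y + 88) * ((1 - x) * (1 - y)) :=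
      mul_nonneg hs (mul_nonneg (by linarith) (by linarith))
    have hedge : 0 ≤ (x + y) * (2 - (x + y)) := mul_nonneg h (by linarith)
    linarith
  · have hcorner : 0 ≤ (x + y + 88) * ((1 + x) * (1 + y)) :=
      mul_nonneg hs (mul_nonneg (by linarith) (by linarith))
    have hedge : 0 ≤ -(x + y) * (34 + (x + y)) := mul_nonneg (by linarith) (by linarith)
    linarith

/-- `(195a/2)((2−2cos θ1)+(2−2cos θ2)) ≤ D(θ1,θ2) ≤ 138a((2−2cos θ1)+(2−2cos θ2))`. -/
theorem stmt9 (θ1 θ2 : ℝ) :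
    (195 * (205891132094649 / 81920000000 : ℝ) / 2) *
        ((2 - 2 * Real.cos θ1) + (2 - 2 * Real.cos θ2)) ≤ DP3 θ1 θ2 ∧
      DP3 θ1 θ2 ≤ 138 * (205891132094649 / 81920000000 : ℝ) *
        ((2 - 2 * Real.cos θ1) + (2 - 2 * Real.cos θ2)) := by
  have hx := Real.neg_one_le_cos θ1
  have hx' := Real.cos_le_one θ1
  have hy := Real.neg_one_le_cos θ2
  have hy' := Real.cos_le_one θ2
  have hl := cubic_lower_bound hx hx' hy hy'
  have hu := cubic_upper_bound hx hx' hy hy'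
  unfold DP3
  constructor <;> linarith
end

section
/- For all θ ∈ ℝ, the determinant of p_{Q3}(θ) equals (1/64)·e^{−3iθ}·(e^{iθ} + 1)⁴. -/
open Matrix Complex

/-- The `3×3` matrix-valued symbol `p_{Q3}` of the prolongation operator used in the
multigrid method for `Q3` Finite Element matrices. -/
noncomputable def pQ3 (θ : ℝ) : Matrix (Fin 3) (Fin 3) ℂ :=
  !![(15 / 16) * Complex.exp (-(Complex.I * θ)),
       1 - (5 / 16) * Complex.exp (-(Complex.I * θ)),
       (1 / 16) * Complex.exp (-(Complex.I * θ)) + (5 / 16) * Complex.exp (Complex.I * θ);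
     Complex.exp (-(Complex.I * θ)) - 5 / 16, 15 / 16,
       5 / 16 + (1 / 16) * Complex.exp (2 * Complex.I * θ);
     (9 / 16) * Complex.exp (-(Complex.I * θ)), (9 / 16) * Complex.exp (-(Complex.I * θ)),
       1 - (1 / 16) * (Complex.exp (Complex.I * θ) + Complex.exp (-(Complex.I * θ)))]

/-- `det(p_{Q3}(θ)) = (1/64) e^{−3iθ} (e^{iθ} + 1)⁴` for all `θ ∈ ℝ`. -/
theorem stmt11 (θ : ℝ) :
    (pQ3 θ).det =
      (1 / 64) * Complex.exp (-(3 * Complex.I * θ)) * (Complex.exp (Complex.I * θ) + 1) ^ 4 := by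
  have h2 : exp (2 * I * θ) = exp (I * θ) ^ 2 := by
    rw [← exp_nat_mul]
    push_cast
    ring_nf
  have h3 : exp (-(3 * I * θ)) = (exp (I * θ))⁻¹ ^ 3 := by
    rw [← exp_neg, ← exp_nat_mul]
    push_cast
    ring_nf
  simp only [pQ3, det_fin_three, of_apply, cons_val, h2, h3, exp_neg (I * θ)]
  field_simp
  ring
end

section
/- Let {A_n}_n be a sequence of Hermitian matrices with A_n of size d_n, where d_n is strictly increasing, and let {P_n}_n be matrices P_n ∈ ℂ^{d_n×δ_n} with P_n* P_n = I_{δ_n}, δ_n ≤ d_n, and δ_n/d_n → 1 as n → ∞. Let f : D ⊆ ℝ^t → ℂ^{r×r} be a measurable Hermitian-matrix-valued function on a measurable set D with 0 < μ_t(D) < ∞. Then {A_n}_n has eigenvalue distribution f if and only if {P_n* A_n P_n}_n has eigenvalue distribution f. -/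
open Matrix MeasureTheory Filter
open scoped BigOperators

/-- A sequence of Hermitian matrices `B n` of sizes `s n` has (asymptotic) eigenvalue
distribution described by the measurable Hermitian-matrix-valued function
`f : D ⊆ ℝ^t → ℂ^{r×r}`: for every continuous function `F : ℝ → ℝ` with compact support,
`(1/s_n) ∑_i F(λ_i(B_n)) → (1/(r·μ_t(D))) ∫_D ∑_i F(λ_i(f(x))) dx`. -/
def EigDistributed {t r : ℕ} (s : ℕ → ℕ)
    (B : (n : ℕ) → Matrix (Fin (s n)) (Fin (s n)) ℂ)
    (hB : ∀ n, (B n).IsHermitian)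
    (D : Set (Fin t → ℝ))
    (f : (Fin t → ℝ) → Matrix (Fin r) (Fin r) ℂ)
    (hf : ∀ x, (f x).IsHermitian) : Prop :=
  ∀ F : ℝ → ℝ, Continuous F → HasCompactSupport F →
    Tendsto (fun n => (1 / (s n : ℝ)) * ∑ i, F ((hB n).eigenvalues i)) atTop
      (nhds ((1 / ((r : ℝ) * (volume D).toReal)) * ∫ x in D, ∑ i, F ((hf x).eigenvalues i)))

lemma star_dotProduct_diagonal_mulVec {n : Type*} [Fintype n] [DecidableEq n]
    (a : n → ℝ) (v : n → ℂ) :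
    star v ⬝ᵥ (diagonal (fun j => (a j : ℂ)) *ᵥ v) = ((∑ j, a j * Complex.normSq (v j) : ℝ) : ℂ) := by
  simp only [dotProduct, mulVec_diagonal, Pi.star_apply, RCLike.star_def]
  push_cast
  refine Finset.sum_congr rfl fun j _ => ?_
  rw [Complex.normSq_eq_conj_mul_self]
  ring

lemma sum_mul_normSq_mulVec {n m : Type*} [Fintype n] [DecidableEq n] [Fintype m] [DecidableEq m]
    {W : Matrix n m ℂ} {a : n → ℝ} {b : m → ℝ}
    (h : Wᴴ * diagonal (fun j => (a j : ℂ)) * W = diagonal (fun i => (b i : ℂ))) (y : m → ℂ) :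
    ∑ j, a j * Complex.normSq ((W *ᵥ y) j) = ∑ i, b i * Complex.normSq (y i) := by
  have key : star (W *ᵥ y) ⬝ᵥ (diagonal (fun j => (a j : ℂ)) *ᵥ (W *ᵥ y)) =
      star y ⬝ᵥ (diagonal (fun i => (b i : ℂ)) *ᵥ y) := by
    rw [← h, star_mulVec, ← dotProduct_mulVec, mulVec_mulVec, mulVec_mulVec, Matrix.mul_assoc]
  rw [star_dotProduct_diagonal_mulVec, star_dotProduct_diagonal_mulVec] at key
  exact_mod_cast key

/-- A linear map sends some nonzero vector supported on `S` to a vector supported on `T`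
as soon as `S` and `T` are large enough. -/
lemma exists_supported_mulVec_supported {n m : Type*} [Fintype n] [DecidableEq n] [Fintype m]
    [DecidableEq m] (W : Matrix n m ℂ) (S : Finset m) (T : Finset n)
    (hST : Fintype.card n < S.card + T.card) :
    ∃ y : m → ℂ, y ≠ 0 ∧ (∀ i ∉ S, y i = 0) ∧ ∀ j ∉ T, (W *ᵥ y) j = 0 := by
  let L : (m → ℂ) →ₗ[ℂ] ((Sᶜ : Finset m) → ℂ) × ((Tᶜ : Finset n) → ℂ) :=
    (LinearMap.funLeft ℂ ℂ Subtype.val).prod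
      ((LinearMap.funLeft ℂ ℂ Subtype.val).comp W.mulVecLin)
  have hL : LinearMap.ker L ≠ ⊥ := by
    apply LinearMap.ker_ne_bot_of_finrank_lt
    have h1 := S.card_le_univ
    have h2 := T.card_le_univ
    simp only [Module.finrank_prod, Module.finrank_fintype_fun_eq_card, Fintype.card_coe,
      Finset.card_compl]
    omega
  obtain ⟨y, hy, hy0⟩ := (Submodule.ne_bot_iff _).1 hL
  rw [LinearMap.mem_ker, Prod.ext_iff] at hy
  refine ⟨y, hy0, fun i hi => ?_, fun j hj => ?_⟩
  · exact congrFun hy.1 ⟨i, Finset.mem_compl.2 hi⟩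
  · exact congrFun hy.2 ⟨j, Finset.mem_compl.2 hj⟩

lemma le_of_compression {n m : Type*} [Fintype n] [DecidableEq n] [Fintype m] [DecidableEq m]
    {W : Matrix n m ℂ} {a : n → ℝ} {b : m → ℝ} (hW : Wᴴ * W = 1)
    (h : Wᴴ * diagonal (fun j => (a j : ℂ)) * W = diagonal (fun i => (b i : ℂ)))
    {S : Finset m} {T : Finset n} (hST : Fintype.card n < S.card + T.card) {α β : ℝ}
    (hS : ∀ i ∈ S, β ≤ b i) (hT : ∀ j ∈ T, a j ≤ α) : β ≤ α := by
  obtain ⟨y, hy0, hyS, hyT⟩ := exists_supported_mulVec_supported W S T hST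
  have hnorm : ∑ j, 1 * Complex.normSq ((W *ᵥ y) j) = ∑ i, 1 * Complex.normSq (y i) :=
    sum_mul_normSq_mulVec (a := fun _ => 1) (b := fun _ => 1) (by simpa using hW) y
  simp only [one_mul] at hnorm
  have hpos : 0 < ∑ i, Complex.normSq (y i) := by
    obtain ⟨i, hi⟩ := Function.ne_iff.1 hy0
    exact Finset.sum_pos' (fun _ _ => Complex.normSq_nonneg _)
      ⟨i, Finset.mem_univ _, Complex.normSq_pos.2 hi⟩
  have hlow : β * ∑ i, Complex.normSq (y i) ≤ ∑ i, b i * Complex.normSq (y i) := by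
    rw [Finset.mul_sum]
    refine Finset.sum_le_sum fun i _ => ?_
    by_cases hi : i ∈ S
    · exact mul_le_mul_of_nonneg_right (hS i hi) (Complex.normSq_nonneg _)
    · simp [hyS i hi]
  have hup : ∑ j, a j * Complex.normSq ((W *ᵥ y) j) ≤
      α * ∑ j, Complex.normSq ((W *ᵥ y) j) := by
    rw [Finset.mul_sum]
    refine Finset.sum_le_sum fun j _ => ?_
    by_cases hj : j ∈ T
    · exact mul_le_mul_of_nonneg_right (hT j hj) (Complex.normSq_nonneg _)
    · simp [hyT j hj]
  rw [sum_mul_normSq_mulVec h, hnorm] at hup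
  exact le_of_mul_le_mul_right (hlow.trans hup) hpos

lemma ge_of_compression {n m : Type*} [Fintype n] [DecidableEq n] [Fintype m] [DecidableEq m]
    {W : Matrix n m ℂ} {a : n → ℝ} {b : m → ℝ} (hW : Wᴴ * W = 1)
    (h : Wᴴ * diagonal (fun j => (a j : ℂ)) * W = diagonal (fun i => (b i : ℂ)))
    {S : Finset m} {T : Finset n} (hST : Fintype.card n < S.card + T.card) {α β : ℝ}
    (hS : ∀ i ∈ S, b i ≤ β) (hT : ∀ j ∈ T, α ≤ a j) : α ≤ β := by
  have h' : Wᴴ * diagonal (fun j => ((-a j : ℝ) : ℂ)) * W =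
      diagonal (fun i => ((-b i : ℝ) : ℂ)) := by
    simp only [Complex.ofReal_neg, ← diagonal_neg, Matrix.mul_neg, Matrix.neg_mul, h]
  exact neg_le_neg_iff.1 (le_of_compression hW h' hST
    (fun i hi => neg_le_neg (hS i hi)) (fun j hj => neg_le_neg (hT j hj)))

/-- A compression of a Hermitian matrix becomes, in eigenbases, a compression of the diagonal
matrix of eigenvalues to the diagonal matrix of eigenvalues. -/
lemma exists_isometry_diagonal_eigenvalues {n m : Type*} [Fintype n] [DecidableEq n] [Fintype m]
    [DecidableEq m] {A : Matrix n n ℂ} (hA : A.IsHermitian) {P : Matrix n m ℂ} (hP : Pᴴ * P = 1)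
    (hPA : (Pᴴ * A * P).IsHermitian) :
    ∃ W : Matrix n m ℂ, Wᴴ * W = 1 ∧
      Wᴴ * diagonal (fun j => (hA.eigenvalues j : ℂ)) * W =
        diagonal (fun i => (hPA.eigenvalues i : ℂ)) := by
  have hV := hA.conjStarAlgAut_star_eigenvectorUnitary
  have hU := hPA.conjStarAlgAut_star_eigenvectorUnitary
  rw [Unitary.conjStarAlgAut_star_apply] at hV hU
  have hV1 : (hA.eigenvectorUnitary : Matrix n n ℂ) * (hA.eigenvectorUnitary : Matrix n n ℂ)ᴴ = 1 :=
    Unitary.coe_mul_star_self _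
  have hU1 : (hPA.eigenvectorUnitary : Matrix m m ℂ)ᴴ * (hPA.eigenvectorUnitary : Matrix m m ℂ) = 1 :=
    Unitary.coe_star_mul_self _
  set V := (hA.eigenvectorUnitary : Matrix n n ℂ)
  set U := (hPA.eigenvectorUnitary : Matrix m m ℂ)
  have cancel (X : Matrix n m ℂ) : V * (Vᴴ * X) = X := by
    rw [← Matrix.mul_assoc, hV1, Matrix.one_mul]
  refine ⟨Vᴴ * P * U, ?_, ?_⟩
  · calc (Vᴴ * P * U)ᴴ * (Vᴴ * P * U) = Uᴴ * (Pᴴ * P) * U := by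
          simp only [conjTranspose_mul, conjTranspose_conjTranspose, Matrix.mul_assoc, cancel]
      _ = 1 := by rw [hP, Matrix.mul_one, hU1]
  · change _ * diagonal (RCLike.ofReal ∘ hA.eigenvalues) * _ =
      diagonal (RCLike.ofReal ∘ hPA.eigenvalues)
    rw [← hV, ← hU]
    simp only [conjTranspose_mul, conjTranspose_conjTranspose, Matrix.mul_assoc, star_eq_conjTranspose,
      cancel]

/-- **Cauchy interlacing**: the increasingly sorted eigenvalues of a Hermitian matrix and of one of
its compressions interlace. -/
lemma exists_interlacing_eigenvalues {d δ : ℕ} {A : Matrix (Fin d) (Fin d) ℂ} (hA : A.IsHermitian)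
    {P : Matrix (Fin d) (Fin δ) ℂ} (hP : Pᴴ * P = 1) (hδ : δ ≤ d)
    (hPA : (Pᴴ * A * P).IsHermitian) :
    ∃ a b : ℕ → ℝ,
      (∀ F : ℝ → ℝ, ∑ i, F (hA.eigenvalues i) = ∑ k ∈ Finset.range d, F (a k)) ∧
      (∀ F : ℝ → ℝ, ∑ i, F (hPA.eigenvalues i) = ∑ k ∈ Finset.range δ, F (b k)) ∧
      ∀ k < δ, a k ≤ b k ∧ b k ≤ a (k + (d - δ)) := by
  obtain ⟨W, hW, h⟩ := exists_isometry_diagonal_eigenvalues hA hP hPA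
  set α := hA.eigenvalues
  set β := hPA.eigenvalues
  have hα := Tuple.monotone_sort α
  have hβ := Tuple.monotone_sort β
  set σ := Tuple.sort α
  set τ := Tuple.sort β
  refine ⟨fun k => if hk : k < d then α (σ ⟨k, hk⟩) else 0,
    fun k => if hk : k < δ then β (τ ⟨k, hk⟩) else 0, fun F => ?_, fun F => ?_, fun k hk => ?_⟩
  · rw [← Fin.sum_univ_eq_sum_range, ← Equiv.sum_comp σ]
    simp
  · rw [← Fin.sum_univ_eq_sum_range, ← Equiv.sum_comp τ]
    simp
  · have hkd : k < d := hk.trans_le hδ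
    have hkm : k + (d - δ) < d := by omega
    simp only [hk, hkd, hkm, dif_pos]
    constructor
    · refine ge_of_compression hW h
        (S := (Finset.Iic (⟨k, hk⟩ : Fin δ)).map τ.toEmbedding)
        (T := (Finset.Ici (⟨k, hkd⟩ : Fin d)).map σ.toEmbedding) ?_ ?_ ?_
      · simp only [Finset.card_map, Fin.card_Iic, Fin.card_Ici, Fintype.card_fin]
        omega
      · intro _ h
        obtain ⟨i, hi, rfl⟩ := Finset.mem_map.1 h
        exact hβ (Finset.mem_Iic.1 hi)
      · intro _ h
        obtain ⟨j, hj, rfl⟩ := Finset.mem_map.1 h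
        exact hα (Finset.mem_Ici.1 hj)
    · refine le_of_compression hW h
        (S := (Finset.Ici (⟨k, hk⟩ : Fin δ)).map τ.toEmbedding)
        (T := (Finset.Iic (⟨k + (d - δ), hkm⟩ : Fin d)).map σ.toEmbedding) ?_ ?_ ?_
      · simp only [Finset.card_map, Fin.card_Iic, Fin.card_Ici, Fintype.card_fin]
        omega
      · intro _ h
        obtain ⟨i, hi, rfl⟩ := Finset.mem_map.1 h
        exact hβ (Finset.mem_Ici.1 hi)
      · intro _ h
        obtain ⟨j, hj, rfl⟩ := Finset.mem_map.1 h
        exact hα (Finset.mem_Iic.1 hj)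

/-- A compactly supported continuous function is, up to a uniform error, Lipschitz with respect to
a bounded monotone function. -/
lemma exists_monotone_bounded_modulus {F : ℝ → ℝ} (hF : Continuous F) (hFs : HasCompactSupport F)
    {ε : ℝ} (hε : 0 < ε) :
    ∃ (c : ℝ → ℝ) (M : ℝ), Monotone c ∧ (∀ x, |c x| ≤ M) ∧
      ∀ x y, x ≤ y → |F x - F y| ≤ ε + (c y - c x) := by
  obtain ⟨C, hC⟩ := hF.bounded_above_of_compact_support hFs
  have hC0 : 0 ≤ C := (norm_nonneg _).trans (hC 0)
  obtain ⟨η, hη, hFη⟩ :=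
    Metric.uniformContinuous_iff.1 (hFs.uniformContinuous_of_continuous hF) ε hε
  obtain ⟨R, hR⟩ := hFs.isCompact.isBounded.subset_closedBall 0
  have hF0 (x : ℝ) (hx : R < |x|) : F x = 0 := by
    by_contra hne
    have := hR (subset_tsupport F hne)
    rw [mem_closedBall_zero_iff, Real.norm_eq_abs] at this
    linarith
  set N : ℝ := |R| + 1
  have hN : R < N := by have := le_abs_self R; simp only [N]; linarith
  have hN0 : 0 < N := by positivity
  let p : ℝ → ℝ := fun x => max (-N) (min x N)
  have hp : Monotone p := fun x y hxy => max_le_max le_rfl (min_le_min hxy le_rfl)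
  have hpN (x : ℝ) : |p x| ≤ N :=
    abs_le.2 ⟨le_max_left _ _, max_le (by linarith) (min_le_right _ _)⟩
  have hFp (x : ℝ) : F (p x) = F x := by
    by_cases hx : |x| ≤ N
    · have := abs_le.1 hx
      simp only [p, min_eq_left this.2, max_eq_right this.1]
    · rw [not_le] at hx
      rw [hF0 x (hN.trans hx), hF0]
      refine hN.trans_le ?_
      rcases lt_abs.1 hx with h | h
      · simp only [p, min_eq_right h.le]
        exact (le_max_right _ _).trans (le_abs_self _)
      · have : p x = -N := max_eq_left ((min_le_left _ _).trans (by linarith))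
        rw [this, abs_neg]
        exact le_abs_self _
  refine ⟨fun x => 2 * C / η * p x, 2 * C / η * N,
    hp.const_mul (by positivity), fun x => ?_, fun x y hxy => ?_⟩
  · rw [abs_mul, abs_of_nonneg (by positivity : 0 ≤ 2 * C / η)]
    exact mul_le_mul_of_nonneg_left (hpN x) (by positivity)
  · have hpxy := hp hxy
    rw [← mul_sub]
    by_cases hlt : p y - p x < η
    · have := hFη (a := p x) (b := p y) (by
        rw [dist_comm, Real.dist_eq, abs_of_nonneg (sub_nonneg.2 hpxy)]; exact hlt)
      rw [hFp, hFp, Real.dist_eq] at this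
      have : 0 ≤ 2 * C / η * (p y - p x) := mul_nonneg (by positivity) (sub_nonneg.2 hpxy)
      linarith
    · rw [not_lt] at hlt
      have h1 : |F x - F y| ≤ 2 * C := by
        have := abs_sub (F x) (F y)
        have := hC x
        have := hC y
        simp only [Real.norm_eq_abs] at *
        linarith
      have h2 : 2 * C / η * η ≤ 2 * C / η * (p y - p x) :=
        mul_le_mul_of_nonneg_left hlt (by positivity)
      rw [div_mul_cancel₀ _ hη.ne'] at h2
      linarith

lemma sum_range_shift_sub_le {g : ℕ → ℝ} {M : ℝ} (hg : ∀ k, |g k| ≤ M) (n m : ℕ) :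
    ∑ k ∈ Finset.range n, (g (k + m) - g k) ≤ 2 * M * m := by
  have h1 := Finset.sum_range_add g m n
  have h2 := Finset.sum_range_add g n m
  rw [add_comm m n, h2] at h1
  have h3 : ∑ k ∈ Finset.range m, (g (n + k) - g k) ≤ ∑ k ∈ Finset.range m, (2 * M) :=
    Finset.sum_le_sum fun k _ => by
      have := abs_le.1 (hg (n + k))
      have := abs_le.1 (hg k)
      linarith
  simp only [Finset.sum_sub_distrib, Finset.sum_const, Finset.card_range, nsmul_eq_mul] at h3 ⊢
  simp only [add_comm _ m]
  linarith

lemma abs_sum_sub_sum_le_of_interlacing {F c : ℝ → ℝ} {C M ε : ℝ} (hC : ∀ x, |F x| ≤ C)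
    (hc : Monotone c) (hM : ∀ x, |c x| ≤ M)
    (hF : ∀ x y, x ≤ y → |F x - F y| ≤ ε + (c y - c x)) {d δ : ℕ} (hδ : δ ≤ d) {a b : ℕ → ℝ}
    (hab : ∀ k < δ, a k ≤ b k ∧ b k ≤ a (k + (d - δ))) :
    |∑ k ∈ Finset.range d, F (a k) - ∑ k ∈ Finset.range δ, F (b k)| ≤
      ε * δ + (2 * M + C) * (d - δ) := by
  obtain ⟨m, rfl⟩ := Nat.exists_eq_add_of_le hδ
  simp only [Nat.add_sub_cancel_left] at hab
  have h1 : |∑ k ∈ Finset.range δ, (F (a k) - F (b k))| ≤ ε * δ + 2 * M * m := by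
    calc |∑ k ∈ Finset.range δ, (F (a k) - F (b k))|
        ≤ ∑ k ∈ Finset.range δ, |F (a k) - F (b k)| := Finset.abs_sum_le_sum_abs _ _
      _ ≤ ∑ k ∈ Finset.range δ, (ε + (c (a (k + m)) - c (a k))) := by
          refine Finset.sum_le_sum fun k hk => ?_
          obtain ⟨hl, hr⟩ := hab k (Finset.mem_range.1 hk)
          linarith [hF _ _ hl, hc hr]
      _ ≤ ε * δ + 2 * M * m := by
          have := sum_range_shift_sub_le (g := fun k => c (a k)) (fun k => hM _) δ m
          rw [Finset.sum_add_distrib, Finset.sum_const, Finset.card_range, nsmul_eq_mul]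
          linarith
  have h2 : |∑ k ∈ Finset.range m, F (a (δ + k))| ≤ C * m := by
    refine (Finset.abs_sum_le_sum_abs _ _).trans ?_
    refine (Finset.sum_le_sum fun k _ => hC _).trans ?_
    rw [Finset.sum_const, Finset.card_range, nsmul_eq_mul, mul_comm]
  rw [Finset.sum_range_add, add_sub_right_comm, ← Finset.sum_sub_distrib]
  refine (abs_add_le _ _).trans ?_
  push_cast
  linarith

/-- Replacing the normalisation `1 / d` by `1 / δ` costs only a multiple of `1 - δ / d`. -/
lemma abs_average_sub_average_le {d δ : ℕ} (hd : 0 < d) (hδ : δ ≤ d) {x y C K ε : ℝ} (hε : 0 ≤ ε)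
    (hC : 0 ≤ C) (hy : |y| ≤ C * δ) (hxy : |x - y| ≤ ε * δ + K * (d - δ)) :
    |1 / (d : ℝ) * x - 1 / (δ : ℝ) * y| ≤ ε + (K + C) * (1 - (δ : ℝ) / d) := by
  have hd' : (0 : ℝ) < d := by exact_mod_cast hd
  have hδ' : (δ : ℝ) ≤ d := by exact_mod_cast hδ
  have hq : (δ : ℝ) / d ≤ 1 := (div_le_one hd').2 hδ'
  have h1 : |1 / (d : ℝ) * (x - y)| ≤ ε + K * (1 - (δ : ℝ) / d) := by
    rw [abs_mul, abs_of_pos (by positivity : 0 < 1 / (d : ℝ))]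
    calc 1 / (d : ℝ) * |x - y| ≤ 1 / (d : ℝ) * (ε * δ + K * (d - δ)) :=
          mul_le_mul_of_nonneg_left hxy (by positivity)
      _ = ε * ((δ : ℝ) / d) + K * (1 - (δ : ℝ) / d) := by field_simp
      _ ≤ ε + K * (1 - (δ : ℝ) / d) := by
          linarith [mul_le_mul_of_nonneg_left hq hε]
  have h2 : |(1 / (d : ℝ) - 1 / (δ : ℝ)) * y| ≤ C * (1 - (δ : ℝ) / d) := by
    rcases Nat.eq_zero_or_pos δ with rfl | hpos
    · have : y = 0 := by simpa using hy
      simp [this, hC]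
    · have hpos' : (0 : ℝ) < δ := by exact_mod_cast hpos
      have hle : 1 / (d : ℝ) ≤ 1 / (δ : ℝ) := one_div_le_one_div_of_le hpos' hδ'
      rw [abs_mul, abs_of_nonpos (sub_nonpos.2 hle)]
      calc -(1 / (d : ℝ) - 1 / (δ : ℝ)) * |y|
          ≤ -(1 / (d : ℝ) - 1 / (δ : ℝ)) * (C * δ) :=
            mul_le_mul_of_nonneg_left hy (by linarith)
        _ = C * (1 - (δ : ℝ) / d) := by field_simp; ring
  calc |1 / (d : ℝ) * x - 1 / (δ : ℝ) * y|
      = |1 / (d : ℝ) * (x - y) + (1 / (d : ℝ) - 1 / (δ : ℝ)) * y| := by congr 1; ring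
    _ ≤ _ := abs_add_le _ _
    _ ≤ ε + (K + C) * (1 - (δ : ℝ) / d) := by linarith

/-- The averages of a test function over the eigenvalues of `A n` and of its compressions have the
same asymptotic behaviour. -/
lemma tendsto_eigenvalue_average_sub {d δ : ℕ → ℕ} (hd : StrictMono d)
    {A : (n : ℕ) → Matrix (Fin (d n)) (Fin (d n)) ℂ} (hA : ∀ n, (A n).IsHermitian)
    {P : (n : ℕ) → Matrix (Fin (d n)) (Fin (δ n)) ℂ}
    (hP : ∀ n, (P n)ᴴ * P n = 1) (hδd : ∀ n, δ n ≤ d n)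
    (hratio : Tendsto (fun n => (δ n : ℝ) / (d n : ℝ)) atTop (nhds 1))
    (hPA : ∀ n, ((P n)ᴴ * A n * P n).IsHermitian)
    {F : ℝ → ℝ} (hF : Continuous F) (hFs : HasCompactSupport F) :
    Tendsto (fun n => (1 / (d n : ℝ)) * ∑ i, F ((hA n).eigenvalues i) -
      (1 / (δ n : ℝ)) * ∑ i, F ((hPA n).eigenvalues i)) atTop (nhds 0) := by
  obtain ⟨C, hC⟩ := hF.bounded_above_of_compact_support hFs
  simp only [Real.norm_eq_abs] at hC
  have hC0 : 0 ≤ C := (abs_nonneg _).trans (hC 0)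
  rw [Metric.tendsto_atTop']
  intro ε hε
  obtain ⟨c, M, hc, hM, hFc⟩ := exists_monotone_bounded_modulus hF hFs (half_pos hε)
  have hlim : Tendsto (fun n => ε / 2 + (2 * M + C + C) * (1 - (δ n : ℝ) / d n)) atTop
      (nhds (ε / 2)) := by
    simpa using ((hratio.const_sub 1).const_mul (2 * M + C + C)).const_add (ε / 2)
  obtain ⟨n₀, hn₀⟩ := eventually_atTop.1 (hlim.eventually (gt_mem_nhds (half_lt_self hε)))
  refine ⟨n₀, fun n hn => ?_⟩
  obtain ⟨a, b, ha, hb, hab⟩ := exists_interlacing_eigenvalues (hA n) (hP n) (hδd n) (hPA n)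
  rw [Real.dist_eq, sub_zero, ha, hb]
  refine lt_of_le_of_lt (abs_average_sub_average_le ((Nat.zero_le _).trans_lt (hd hn)) (hδd n)
    (half_pos hε).le hC0 ?_
    (abs_sum_sub_sum_le_of_interlacing hC hc hM hFc (hδd n) hab)) (hn₀ n hn.le)
  refine (Finset.abs_sum_le_sum_abs _ _).trans ((Finset.sum_le_sum fun k _ => hC _).trans ?_)
  rw [Finset.sum_const, Finset.card_range, nsmul_eq_mul, mul_comm]

/-- Let `{A_n}` be Hermitian matrices of strictly increasing sizes `d n`, and let
`P_n ∈ ℂ^{d_n×δ_n}` satisfy `P_n* P_n = I`, `δ_n ≤ d_n`, `δ_n/d_n → 1`. Let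
`f : D ⊆ ℝ^t → ℂ^{r×r}` be a measurable Hermitian-matrix-valued function on a
measurable set `D` with `0 < μ_t(D) < ∞`. Then `{A_n}` has eigenvalue distribution `f`
iff `{P_n* A_n P_n}` has eigenvalue distribution `f`. -/
theorem stmt12 {t r : ℕ} (d δ : ℕ → ℕ) (hd : StrictMono d)
    (A : (n : ℕ) → Matrix (Fin (d n)) (Fin (d n)) ℂ) (hA : ∀ n, (A n).IsHermitian)
    (P : (n : ℕ) → Matrix (Fin (d n)) (Fin (δ n)) ℂ)
    (hP : ∀ n, (P n)ᴴ * P n = 1) (hδd : ∀ n, δ n ≤ d n)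
    (hratio : Tendsto (fun n => (δ n : ℝ) / (d n : ℝ)) atTop (nhds 1))
    (D : Set (Fin t → ℝ)) (hD : MeasurableSet D)
    (hD0 : 0 < volume D) (hDtop : volume D < ⊤)
    (f : (Fin t → ℝ) → Matrix (Fin r) (Fin r) ℂ)
    (hfm : ∀ a b, Measurable fun x => f x a b)
    (hf : ∀ x, (f x).IsHermitian)
    (hPA : ∀ n, ((P n)ᴴ * A n * P n).IsHermitian) :
    EigDistributed d A hA D f hf ↔
      EigDistributed δ (fun n => (P n)ᴴ * A n * P n) hPA D f hf := by
  refine forall_congr' fun F => forall_congr' fun hF => forall_congr' fun hFs => ?_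
  have h := tendsto_eigenvalue_average_sub hd hA hP hδd hratio hPA hF hFs
  exact ⟨fun hlim => by simpa using hlim.sub h, fun hlim => by simpa using hlim.add h⟩
end

section
/- Let A ∈ ℂ^{n×n} be Hermitian positive definite, let P ∈ ℂ^{n×m} with n > m be a full-rank matrix, and let V ∈ ℂ^{n×n}. Suppose there exists α > 0 such that ‖Vx‖_A² ≤ ‖x‖_A² − α‖Ax‖₂² for all x ∈ ℂ^n (smoothing property), and there exists β > 0 such that inf_{y ∈ ℂ^m} ‖x − Py‖₂² ≤ β‖x‖_A² for all x ∈ ℂ^n (approximation property). Let CGC = I − P(P*AP)^{−1}P*A. Then α ≤ β, and for all x ∈ ℂ^n, ‖V(CGC·x)‖_A ≤ √(1 − α/β)·‖x‖_A. -/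
open Matrix
open scoped ComplexConjugate ComplexOrder

/-- Squared energy norm `‖x‖_A² = x* A x` (real part). -/
noncomputable def sqA {n : ℕ} (A : Matrix (Fin n) (Fin n) ℂ) (x : Fin n → ℂ) : ℝ :=
  (star x ⬝ᵥ A.mulVec x).re

/-- Squared Euclidean norm `‖x‖₂² = x* x` (real part). -/
noncomputable def sq2 {n : ℕ} (x : Fin n → ℂ) : ℝ :=
  (star x ⬝ᵥ x).re

lemma sq2_eq_norm_sq {n : ℕ} (x : Fin n → ℂ) : sq2 x = ‖WithLp.toLp 2 x‖ ^ 2 := by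
  rw [sq2, ← inner_self_eq_norm_sq (𝕜 := ℂ), EuclideanSpace.inner_toLp_toLp, dotProduct_comm]
  rfl

lemma sq2_nonneg {n : ℕ} (x : Fin n → ℂ) : 0 ≤ sq2 x := by
  rw [sq2_eq_norm_sq]
  positivity

/-- Cauchy–Schwarz inequality. -/
lemma sq_re_dotProduct_le {n : ℕ} (x y : Fin n → ℂ) :
    (star x ⬝ᵥ y).re ^ 2 ≤ sq2 x * sq2 y := by
  have h' := norm_inner_le_norm (𝕜 := ℂ) (WithLp.toLp 2 x) (WithLp.toLp 2 y)
  have hre := Complex.abs_re_le_norm (star x ⬝ᵥ y)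
  rw [EuclideanSpace.inner_toLp_toLp, dotProduct_comm] at h'
  rw [sq2_eq_norm_sq, sq2_eq_norm_sq, ← mul_pow, ← sq_abs]
  exact pow_le_pow_left₀ (abs_nonneg _) (hre.trans h') 2

lemma sqA_pos {n : ℕ} {A : Matrix (Fin n) (Fin n) ℂ} (hA : A.PosDef) {x : Fin n → ℂ}
    (hx : x ≠ 0) : 0 < sqA A x :=
  hA.re_dotProduct_pos hx

lemma sqA_nonneg {n : ℕ} {A : Matrix (Fin n) (Fin n) ℂ} (hA : A.PosDef) (x : Fin n → ℂ) :
    0 ≤ sqA A x :=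
  hA.posSemidef.re_dotProduct_nonneg x

lemma mulVec_injective_of_rank_eq {n m : ℕ} {P : Matrix (Fin n) (Fin m) ℂ} (hP : P.rank = m) :
    Function.Injective P.mulVec := by
  have h := P.mulVecLin.finrank_range_add_finrank_ker
  rw [Module.finrank_fin_fun, ← Matrix.rank, hP] at h
  have hker : LinearMap.ker P.mulVecLin = ⊥ := Submodule.finrank_eq_zero.mp (by omega)
  exact LinearMap.ker_eq_bot.mp hker

lemma exists_ne_zero_mulVec_eq_zero {n m : ℕ} (hnm : m < n) (B : Matrix (Fin m) (Fin n) ℂ) :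
    ∃ x ≠ 0, B.mulVec x = 0 := by
  have hker : LinearMap.ker B.mulVecLin ≠ ⊥ :=
    LinearMap.ker_ne_bot_of_finrank_lt (by simpa using hnm)
  obtain ⟨x, hx, hx0⟩ := Submodule.exists_mem_ne_zero_of_ne_bot hker
  exact ⟨x, hx0, hx⟩

lemma star_mulVec_dotProduct {n m : ℕ} (P : Matrix (Fin n) (Fin m) ℂ) (y : Fin m → ℂ)
    (z : Fin n → ℂ) : star (P.mulVec y) ⬝ᵥ z = star y ⬝ᵥ Pᴴ.mulVec z := by
  rw [star_mulVec, ← dotProduct_mulVec]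

/-- On vectors `A`-orthogonal to the range of `P`, the approximation property bounds the energy
norm by the norm of the residual. -/
lemma sqA_le_of_approx {n m : ℕ} {A : Matrix (Fin n) (Fin n) ℂ} (hA : A.PosDef)
    {P : Matrix (Fin n) (Fin m) ℂ} {β : ℝ} (hβ : 0 < β) {e : Fin n → ℂ}
    (happrox : (⨅ y : Fin m → ℂ, sq2 (e - P.mulVec y)) ≤ β * sqA A e)
    (he : Pᴴ.mulVec (A.mulVec e) = 0) : sqA A e ≤ β * sq2 (A.mulVec e) := by
  have hr := sq2_nonneg (A.mulVec e)
  have hcs (y : Fin m → ℂ) : sqA A e ^ 2 ≤ sq2 (A.mulVec e) * sq2 (e - P.mulVec y) := by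
    have h := sq_re_dotProduct_le (e - P.mulVec y) (A.mulVec e)
    rw [star_sub, sub_dotProduct, star_mulVec_dotProduct, he, dotProduct_zero, sub_zero] at h
    rwa [mul_comm]
  have hinf : sqA A e ^ 2 ≤ sq2 (A.mulVec e) * ⨅ y : Fin m → ℂ, sq2 (e - P.mulVec y) := by
    rw [Real.mul_iInf_of_nonneg hr]
    exact le_ciInf hcs
  have hmul : sqA A e * sqA A e ≤ (β * sq2 (A.mulVec e)) * sqA A e := by
    have := mul_le_mul_of_nonneg_left happrox hr
    linarith
  rcases (sqA_nonneg hA e).eq_or_lt with h0 | hpos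
  · rw [← h0]
    positivity
  · exact le_of_mul_le_mul_right hmul hpos

/-- Pythagoras in the energy norm. -/
lemma sqA_add_mulVec {n m : ℕ} {A : Matrix (Fin n) (Fin n) ℂ} (hA : A.PosDef)
    {P : Matrix (Fin n) (Fin m) ℂ} {e : Fin n → ℂ} (he : Pᴴ.mulVec (A.mulVec e) = 0)
    (y : Fin m → ℂ) : sqA A (e + P.mulVec y) = sqA A e + sqA A (P.mulVec y) := by
  have h₁ : star (P.mulVec y) ⬝ᵥ A.mulVec e = 0 := by
    rw [star_mulVec_dotProduct, he, dotProduct_zero]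
  have h₂ : star e ⬝ᵥ A.mulVec (P.mulVec y) = 0 := by
    have h := congrArg star h₁
    rwa [star_dotProduct, star_zero, star_star, star_mulVec_dotProduct, hA.isHermitian.eq] at h
  simp only [sqA, star_add, mulVec_add, add_dotProduct, dotProduct_add, h₁, h₂, add_zero,
    zero_add, Complex.add_re]

/-- The residual of a coarse grid correction vanishes on the coarse space. -/
lemma conjTranspose_mulVec_coarseGridCorrection {n m : ℕ} {A : Matrix (Fin n) (Fin n) ℂ}
    (hA : A.PosDef) {P : Matrix (Fin n) (Fin m) ℂ} (hP : P.rank = m) (x : Fin n → ℂ) :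
    Pᴴ.mulVec (A.mulVec ((1 - P * (Pᴴ * A * P)⁻¹ * Pᴴ * A).mulVec x)) = 0 := by
  have hunit : IsUnit (Pᴴ * A * P).det :=
    (isUnit_iff_isUnit_det _).mp
      (hA.conjTranspose_mul_mul_same (mulVec_injective_of_rank_eq hP)).isUnit
  have h : Pᴴ * (A * (1 - P * (Pᴴ * A * P)⁻¹ * Pᴴ * A)) = 0 := by
    calc Pᴴ * (A * (1 - P * (Pᴴ * A * P)⁻¹ * Pᴴ * A))
        = Pᴴ * A - (Pᴴ * A * P) * (Pᴴ * A * P)⁻¹ * (Pᴴ * A) := by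
          simp only [Matrix.mul_sub, Matrix.mul_one, Matrix.mul_assoc]
      _ = 0 := by rw [mul_nonsing_inv _ hunit, Matrix.one_mul, sub_self]
  rw [mulVec_mulVec, mulVec_mulVec, Matrix.mul_assoc, h, zero_mulVec]

/-- Two-grid convergence theorem (Ruge–Stüben): if the post-smoother `V` satisfies the
smoothing property with constant `α > 0` and the full-rank prolongation `P` satisfies the
approximation property with constant `β > 0`, then `α ≤ β` and the two-grid iteration
matrix `V·CGC`, with `CGC = I − P(P*AP)⁻¹P*A`, is a contraction in the energy norm with
factor `√(1 − α/β)`. -/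
theorem stmt13 {n m : ℕ} (hnm : m < n)
    (A : Matrix (Fin n) (Fin n) ℂ) (hA : A.PosDef)
    (P : Matrix (Fin n) (Fin m) ℂ) (hP : P.rank = m)
    (V : Matrix (Fin n) (Fin n) ℂ) (α β : ℝ) (hα : 0 < α) (hβ : 0 < β)
    (hsmooth : ∀ x : Fin n → ℂ, sqA A (V.mulVec x) ≤ sqA A x - α * sq2 (A.mulVec x))
    (happrox : ∀ x : Fin n → ℂ, (⨅ y : Fin m → ℂ, sq2 (x - P.mulVec y)) ≤ β * sqA A x) :
    α ≤ β ∧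
      ∀ x : Fin n → ℂ,
        Real.sqrt (sqA A (V.mulVec ((1 - P * (Pᴴ * A * P)⁻¹ * Pᴴ * A).mulVec x))) ≤
          Real.sqrt (1 - α / β) * Real.sqrt (sqA A x) := by
  have hcontract (e : Fin n → ℂ) (he : Pᴴ.mulVec (A.mulVec e) = 0) :
      sqA A (V.mulVec e) ≤ (1 - α / β) * sqA A e := by
    have hle : α / β * sqA A e ≤ α * sq2 (A.mulVec e) :=
      calc α / β * sqA A e ≤ α / β * (β * sq2 (A.mulVec e)) := by
            gcongr
            exact sqA_le_of_approx hA hβ (happrox e) he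
        _ = α * sq2 (A.mulVec e) := by field_simp
    linarith [hsmooth e]
  have hfactor : 0 ≤ 1 - α / β := by
    obtain ⟨e, he0, he⟩ := exists_ne_zero_mulVec_eq_zero hnm (Pᴴ * A)
    rw [← mulVec_mulVec] at he
    exact nonneg_of_mul_nonneg_left ((sqA_nonneg hA _).trans (hcontract e he)) (sqA_pos hA he0)
  refine ⟨(div_le_one hβ).mp (sub_nonneg.mp hfactor), fun x => ?_⟩
  have he := conjTranspose_mulVec_coarseGridCorrection hA hP x
  set e := (1 - P * (Pᴴ * A * P)⁻¹ * Pᴴ * A).mulVec x with he_def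
  have hx : x = e + P.mulVec (((Pᴴ * A * P)⁻¹ * Pᴴ * A).mulVec x) := by
    rw [he_def, mulVec_mulVec, ← add_mulVec]
    simp only [Matrix.mul_assoc, sub_add_cancel, one_mulVec]
  have hex : sqA A e ≤ sqA A x := by
    rw [hx, sqA_add_mulVec hA he]
    exact le_add_of_nonneg_right (sqA_nonneg hA _)
  rw [← Real.sqrt_mul hfactor]
  exact Real.sqrt_le_sqrt ((hcontract e he).trans (mul_le_mul_of_nonneg_left hex hfactor))
end

section
/- The matrix-sequence {T_n(f_{P2})}_n is spectrally distributed as f_{P2}: for every continuous function F : ℝ → ℝ with compact support, lim_{n→∞} (1/(4n²)) ∑_{i=1}^{4n²} F(λ_i(T_n(f_{P2}))) = (1/(4·(2π)²)) ∫_{[−π,π]²} ∑_{i=1}^{4} F(λ_i(f_{P2}(θ1,θ2))) dθ1 dθ2, where λ_i(·) denote the real eigenvalues of the Hermitian matrices involved. -/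
open Matrix Complex

/-- The Fourier coefficients `f̂_{(k1,k2)}` of `f_{P2}`, computed entrywise:
`f̂_{(k1,k2)} = (1/(2π)²) ∫_{[−π,π]²} f_{P2}(θ1,θ2) e^{−i(k1θ1+k2θ2)} dθ1 dθ2`. -/
noncomputable def fhatP2 (k1 k2 : ℤ) : Matrix (Fin 4) (Fin 4) ℂ :=
  Matrix.of fun a b =>
    (1 / (2 * Real.pi) ^ 2 : ℂ) *
      ∫ θ1 in (-Real.pi)..Real.pi, ∫ θ2 in (-Real.pi)..Real.pi,
        fP2 θ1 θ2 a b * Complex.exp (-(Complex.I * ((k1 : ℂ) * θ1 + (k2 : ℂ) * θ2)))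

/-- The two-level block Toeplitz matrix `T_n(f_{P2})` of size `4n²`: the `4×4` block in
block position `((i1,i2),(j1,j2))` equals `f̂_{(i1−j1, i2−j2)}`. -/
noncomputable def TbP2 (n : ℕ) :
    Matrix ((Fin n × Fin n) × Fin 4) ((Fin n × Fin n) × Fin 4) ℂ :=
  Matrix.of fun p q =>
    fhatP2 ((p.1.1 : ℤ) - (q.1.1 : ℤ)) ((p.1.2 : ℤ) - (q.1.2 : ℤ)) p.2 q.2

open Filter
open scoped BigOperators

/-- The `k`-th Fourier coefficient of a function on `[-π, π]²`. -/
noncomputable def fourierCoeffSq (g : ℝ → ℝ → ℂ) (k : ℤ × ℤ) : ℂ :=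
  (1 / (2 * Real.pi) ^ 2 : ℂ) *
    ∫ θ1 in (-Real.pi)..Real.pi, ∫ θ2 in (-Real.pi)..Real.pi,
      g θ1 θ2 * cexp (-(I * ((k.1 : ℂ) * θ1 + (k.2 : ℂ) * θ2)))

theorem integral_integral_finset_sum {ι E : Type*} [NormedAddCommGroup E] [NormedSpace ℝ E]
    (s : Finset ι) (g : ι → ℝ → ℝ → E)
    (hg : ∀ i ∈ s, Continuous fun x : ℝ × ℝ => g i x.1 x.2) (a b c d : ℝ) :
    ∫ x in a..b, ∫ y in c..d, ∑ i ∈ s, g i x y =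
      ∑ i ∈ s, ∫ x in a..b, ∫ y in c..d, g i x y := by
  rw [← intervalIntegral.integral_finsetSum]
  · refine intervalIntegral.integral_congr fun x _ => ?_
    refine intervalIntegral.integral_finsetSum fun i hi => ?_
    exact ((hg i hi).comp (Continuous.prodMk_right x)).intervalIntegrable _ _
  · intro i hi
    exact (intervalIntegral.continuous_parametric_intervalIntegral_of_continuous'
      (f := g i) (hg i hi) c d).intervalIntegrable _ _

theorem fourierCoeffSq_sum {ι : Type*} (s : Finset ι) (g : ι → ℝ → ℝ → ℂ)
    (hg : ∀ i ∈ s, Continuous fun x : ℝ × ℝ => g i x.1 x.2) (k : ℤ × ℤ) :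
    fourierCoeffSq (fun x y => ∑ i ∈ s, g i x y) k = ∑ i ∈ s, fourierCoeffSq (g i) k := by
  simp only [fourierCoeffSq, Finset.sum_mul, ← Finset.mul_sum]
  rw [integral_integral_finset_sum]
  intro i hi
  have := hg i hi
  fun_prop

theorem fourierCoeffSq_const_mul (z : ℂ) (g : ℝ → ℝ → ℂ) (k : ℤ × ℤ) :
    fourierCoeffSq (fun x y => z * g x y) k = z * fourierCoeffSq g k := by
  simp only [fourierCoeffSq, mul_assoc z, intervalIntegral.integral_const_mul]
  ring

theorem fourierCoeffSq_exp_mul (s : ℤ × ℤ) (g : ℝ → ℝ → ℂ) (k : ℤ × ℤ) :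
    fourierCoeffSq (fun x y => cexp (I * ((s.1 : ℂ) * x + (s.2 : ℂ) * y)) * g x y) k =
      fourierCoeffSq g (k - s) := by
  simp only [fourierCoeffSq]
  refine congrArg _ (intervalIntegral.integral_congr fun x _ =>
    intervalIntegral.integral_congr fun y _ => ?_)
  rw [mul_comm (cexp _), mul_assoc, ← Complex.exp_add]
  congr 2
  push_cast [Prod.fst_sub, Prod.snd_sub]
  ring

theorem integral_exp_int_mul (k : ℤ) :
    ∫ x in (-Real.pi)..Real.pi, cexp (-(I * (k * x))) =
      if k = 0 then 2 * (Real.pi : ℂ) else 0 := by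
  split_ifs with h
  · subst h
    simp
    ring
  · have hc : -(I * k) ≠ 0 := by simp [h, I_ne_zero]
    have := integral_exp_mul_complex (a := -Real.pi) (b := Real.pi) hc
    simp only [neg_mul, mul_assoc] at this
    rw [this, div_eq_zero_iff, sub_eq_zero]
    left
    rw [Complex.exp_eq_exp_iff_exists_int]
    refine ⟨-k, ?_⟩
    push_cast
    ring

theorem fourierCoeffSq_one (k : ℤ × ℤ) :
    fourierCoeffSq (fun _ _ => 1) k = if k = 0 then 1 else 0 := by
  have hexp : ∀ x y : ℝ, cexp (-(I * ((k.1 : ℂ) * x + (k.2 : ℂ) * y))) =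
      cexp (-(I * (k.1 * x))) * cexp (-(I * (k.2 * y))) := fun x y => by
    rw [← Complex.exp_add]; congr 1; ring
  simp only [fourierCoeffSq, one_mul, hexp, intervalIntegral.integral_const_mul,
    intervalIntegral.integral_mul_const, integral_exp_int_mul]
  have hpi : (Real.pi : ℂ) ≠ 0 := by exact_mod_cast Real.pi_ne_zero
  by_cases h1 : k.1 = 0 <;> by_cases h2 : k.2 = 0 <;> simp [h1, h2, Prod.ext_iff]
  field_simp

section Symbol

variable {κ : Type*} [Fintype κ] [DecidableEq κ]

/-- The matrix-valued trigonometric polynomial with coefficients `c` on `S`. -/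
noncomputable def trigPoly (S : Finset (ℤ × ℤ)) (c : ℤ × ℤ → Matrix κ κ ℂ) (x y : ℝ) :
    Matrix κ κ ℂ :=
  ∑ s ∈ S, cexp (I * ((s.1 : ℂ) * x + (s.2 : ℂ) * y)) • c s

/-- The two-level block Toeplitz matrix with blocks `c (i - j)`. -/
def blockToeplitz (c : ℤ × ℤ → Matrix κ κ ℂ) (n : ℕ) :
    Matrix ((Fin n × Fin n) × κ) ((Fin n × Fin n) × κ) ℂ :=
  Matrix.of fun p q => c ((p.1.1 : ℤ) - (q.1.1 : ℤ), (p.1.2 : ℤ) - (q.1.2 : ℤ)) p.2 q.2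

omit [Fintype κ] [DecidableEq κ] in
theorem continuous_trigPoly (S : Finset (ℤ × ℤ)) (c : ℤ × ℤ → Matrix κ κ ℂ) :
    Continuous fun x : ℝ × ℝ => trigPoly S c x.1 x.2 := by
  unfold trigPoly
  fun_prop

theorem continuous_trigPoly_pow_apply (S : Finset (ℤ × ℤ)) (c : ℤ × ℤ → Matrix κ κ ℂ)
    (m : ℕ) (a b : κ) : Continuous fun x : ℝ × ℝ => (trigPoly S c x.1 x.2 ^ m) a b :=
  ((continuous_trigPoly S c).pow m).matrix_elem a b

omit [DecidableEq κ] in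
theorem fourierCoeffSq_trigPoly_mul (S : Finset (ℤ × ℤ)) (c : ℤ × ℤ → Matrix κ κ ℂ)
    (g : ℝ → ℝ → Matrix κ κ ℂ)
    (hg : ∀ a b, Continuous fun x : ℝ × ℝ => g x.1 x.2 a b) (a b : κ) (k : ℤ × ℤ) :
    fourierCoeffSq (fun x y => (trigPoly S c x y * g x y) a b) k =
      ∑ s ∈ S, ∑ e, c s a e * fourierCoeffSq (fun x y => g x y e b) (k - s) := by
  have h : ∀ x y, (trigPoly S c x y * g x y) a b = ∑ s ∈ S, ∑ e,
      c s a e * (cexp (I * ((s.1 : ℂ) * x + (s.2 : ℂ) * y)) * g x y e b) := fun x y => by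
    simp only [Matrix.mul_apply, trigPoly, Matrix.sum_apply, Matrix.smul_apply, smul_eq_mul,
      Finset.sum_mul]
    rw [Finset.sum_comm]
    refine Finset.sum_congr rfl fun s _ => Finset.sum_congr rfl fun e _ => by ring
  simp only [h]
  rw [fourierCoeffSq_sum]
  · refine Finset.sum_congr rfl fun s _ => ?_
    rw [fourierCoeffSq_sum]
    · refine Finset.sum_congr rfl fun e _ => ?_
      rw [fourierCoeffSq_const_mul, fourierCoeffSq_exp_mul]
    · intro e _
      have := hg e b
      fun_prop
  · intro s _
    have := fun e => hg e b
    fun_prop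

omit [Fintype κ] in
theorem fourierCoeffSq_one_apply (a b : κ) (k : ℤ × ℤ) :
    fourierCoeffSq (fun _ _ => (1 : Matrix κ κ ℂ) a b) k =
      if k = 0 then (1 : Matrix κ κ ℂ) a b else 0 := by
  have := fourierCoeffSq_const_mul ((1 : Matrix κ κ ℂ) a b) (fun _ _ => 1) k
  simpa [fourierCoeffSq_one] using this

theorem fourierCoeffSq_trigPoly (S : Finset (ℤ × ℤ)) (c : ℤ × ℤ → Matrix κ κ ℂ)
    (hc : ∀ s ∉ S, c s = 0) (a b : κ) (k : ℤ × ℤ) :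
    fourierCoeffSq (fun x y => trigPoly S c x y a b) k = c k a b := by
  have h := fourierCoeffSq_trigPoly_mul S c (fun _ _ => 1) (fun _ _ => continuous_const) a b k
  simp only [mul_one, fourierCoeffSq_one_apply, sub_eq_zero] at h
  rw [h]
  by_cases hk : k ∈ S
  · rw [Finset.sum_eq_single k]
    · simp [Matrix.one_apply]
    · intro s _ hs
      simp [hs.symm]
    · exact fun h => absurd hk h
  · rw [hc k hk]
    refine Finset.sum_eq_zero fun s hs => ?_
    have : k ≠ s := fun h => hk (h ▸ hs)
    simp [this]

theorem blockToeplitz_pow_apply (S : Finset (ℤ × ℤ)) (c : ℤ × ℤ → Matrix κ κ ℂ)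
    (hc : ∀ s ∉ S, c s = 0) (N : ℕ)
    (hS : ∀ s ∈ S, |s.1| ≤ N ∧ |s.2| ≤ N) (n m : ℕ) :
    ∀ p q : (Fin n × Fin n) × κ,
      N * m ≤ (p.1.1 : ℕ) → p.1.1 + N * m < n → N * m ≤ (p.1.2 : ℕ) → p.1.2 + N * m < n →
      (blockToeplitz c n ^ m) p q =
        fourierCoeffSq (fun x y => (trigPoly S c x y ^ m) p.2 q.2)
          ((p.1.1 : ℤ) - (q.1.1 : ℤ), (p.1.2 : ℤ) - (q.1.2 : ℤ)) := by
  induction m with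
  | zero =>
    rintro ⟨⟨i1, i2⟩, a⟩ ⟨⟨j1, j2⟩, b⟩ _ _ _ _
    simp only [pow_zero]
    rw [fourierCoeffSq_one_apply]
    simp only [Matrix.one_apply, Prod.ext_iff, Fin.ext_iff, Prod.fst_zero, Prod.snd_zero,
      sub_eq_zero, Nat.cast_inj]
    split_ifs <;> simp_all
  | succ m ih =>
    rintro ⟨⟨i1, i2⟩, a⟩ ⟨⟨j1, j2⟩, b⟩ h1 h2 h3 h4
    simp only [mul_add, mul_one] at h1 h2 h3 h4
    simp only [pow_succ']
    rw [fourierCoeffSq_trigPoly_mul S c _ (continuous_trigPoly_pow_apply S c m), Matrix.mul_apply,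
      Fintype.sum_prod_type]
    have hzero : ∀ l : Fin n × Fin n, (((i1 : ℤ) - l.1, (i2 : ℤ) - l.2) : ℤ × ℤ) ∉ S →
        ∑ e, blockToeplitz c n ((i1, i2), a) (l, e) *
          (blockToeplitz c n ^ m) (l, e) ((j1, j2), b) = 0 := fun l hl =>
      Finset.sum_eq_zero fun e _ => by simp [blockToeplitz, hc _ hl]
    rw [← Finset.sum_filter_of_ne (p := fun l : Fin n × Fin n =>
      (((i1 : ℤ) - l.1, (i2 : ℤ) - l.2) : ℤ × ℤ) ∈ S)
      fun l _ hne => by_contra fun hl => hne (hzero l hl)]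
    refine Finset.sum_bij (fun l _ => ((i1 : ℤ) - l.1, (i2 : ℤ) - l.2)) ?_ ?_ ?_ ?_
    · intro l hl
      exact (Finset.mem_filter.1 hl).2
    · rintro ⟨l1, l2⟩ _ ⟨l1', l2'⟩ _ h
      simp only [Prod.mk.injEq, sub_right_inj, Nat.cast_inj, Fin.val_inj] at h
      simp [h]
    · rintro ⟨s1, s2⟩ hs
      obtain ⟨hs1, hs2⟩ := hS _ hs
      simp only [abs_le] at hs1 hs2
      refine ⟨(⟨(i1 - s1).toNat, by omega⟩, ⟨(i2 - s2).toNat, by omega⟩), ?_, ?_⟩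
      · rw [Finset.mem_filter]
        refine ⟨Finset.mem_univ _, ?_⟩
        convert hs using 2 <;> simp only <;> omega
      · ext <;> simp only <;> omega
    · rintro ⟨l1, l2⟩ hl
      obtain ⟨hs1, hs2⟩ := hS _ (Finset.mem_filter.1 hl).2
      simp only [abs_le] at hs1 hs2
      refine Finset.sum_congr rfl fun e _ => ?_
      rw [ih ((l1, l2), e) ((j1, j2), b) (by simp only; omega) (by simp only; omega)
        (by simp only; omega) (by simp only; omega)]
      simp only [blockToeplitz, Matrix.of_apply, Prod.mk_sub_mk, sub_sub_sub_cancel_left]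

/-- The sum of the norms of all entries of the coefficients `c` on `S`. -/
noncomputable def coeffNormSum (S : Finset (ℤ × ℤ)) (c : ℤ × ℤ → Matrix κ κ ℂ) : ℝ :=
  ∑ s ∈ S, ∑ a, ∑ b, ‖c s a b‖

omit [DecidableEq κ] in
theorem sum_row_le_coeffNormSum (S : Finset (ℤ × ℤ)) (c : ℤ × ℤ → Matrix κ κ ℂ) (a : κ) :
    ∑ s ∈ S, ∑ b, ‖c s a b‖ ≤ coeffNormSum S c :=
  Finset.sum_le_sum fun s _ =>
    Finset.single_le_sum (f := fun a => ∑ b, ‖c s a b‖) (fun _ _ => by positivity)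
      (Finset.mem_univ a)

omit [DecidableEq κ] in
theorem coeffNormSum_nonneg (S : Finset (ℤ × ℤ)) (c : ℤ × ℤ → Matrix κ κ ℂ) :
    0 ≤ coeffNormSum S c := by
  unfold coeffNormSum
  positivity

omit [DecidableEq κ] in
theorem trigPoly_row_sum_le (S : Finset (ℤ × ℤ)) (c : ℤ × ℤ → Matrix κ κ ℂ) (x y : ℝ) (a : κ) :
    ∑ b, ‖trigPoly S c x y a b‖ ≤ coeffNormSum S c := by
  refine le_trans ?_ (sum_row_le_coeffNormSum S c a)
  rw [Finset.sum_comm]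
  refine Finset.sum_le_sum fun b _ => ?_
  rw [trigPoly, Matrix.sum_apply]
  refine (norm_sum_le _ _).trans (Finset.sum_le_sum fun s _ => ?_)
  rw [Matrix.smul_apply, norm_smul, mul_comm I,
    show ((s.1 : ℂ) * x + (s.2 : ℂ) * y) = ((s.1 * x + s.2 * y : ℝ) : ℂ) by push_cast; ring,
    Complex.norm_exp_ofReal_mul_I, one_mul]

omit [DecidableEq κ] in
theorem blockToeplitz_row_sum_le (S : Finset (ℤ × ℤ)) (c : ℤ × ℤ → Matrix κ κ ℂ)
    (hc : ∀ s ∉ S, c s = 0) (n : ℕ) (p : (Fin n × Fin n) × κ) :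
    ∑ q, ‖blockToeplitz c n p q‖ ≤ coeffNormSum S c := by
  obtain ⟨⟨i1, i2⟩, a⟩ := p
  refine le_trans ?_ (sum_row_le_coeffNormSum S c a)
  rw [Fintype.sum_prod_type]
  simp only [blockToeplitz, Matrix.of_apply]
  set φ : Fin n × Fin n → ℤ × ℤ := fun l => ((i1 : ℤ) - l.1, (i2 : ℤ) - l.2) with hφ
  have hinj : Function.Injective φ := by
    rintro ⟨l1, l2⟩ ⟨l1', l2'⟩ h
    simp only [hφ, Prod.mk.injEq, sub_right_inj, Nat.cast_inj, Fin.val_inj] at h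
    simp [h]
  rw [← Finset.sum_filter_of_ne (p := fun l => φ l ∈ S)
    fun l _ hne => by_contra fun hl => hne
      (Finset.sum_eq_zero fun b _ => by
        rw [show c ((i1 : ℤ) - l.1, (i2 : ℤ) - l.2) = 0 from hc _ hl, Matrix.zero_apply,
          norm_zero])]
  rw [← Finset.sum_image (g := φ) (f := fun s => ∑ b, ‖c s a b‖) hinj.injOn]
  refine Finset.sum_le_sum_of_subset_of_nonneg ?_ fun _ _ _ => by positivity
  intro s hs
  obtain ⟨l, hl, rfl⟩ := Finset.mem_image.1 hs
  exact (Finset.mem_filter.1 hl).2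

theorem pow_row_sum_le {ι : Type*} [Fintype ι] [DecidableEq ι] (A : Matrix ι ι ℂ) {R : ℝ}
    (hA : ∀ p, ∑ q, ‖A p q‖ ≤ R) (hR : 0 ≤ R) (m : ℕ) (p : ι) :
    ∑ q, ‖(A ^ m) p q‖ ≤ R ^ m := by
  induction m generalizing p with
  | zero => simp [Matrix.one_apply, apply_ite]
  | succ m ih =>
    calc ∑ q, ‖(A ^ (m + 1)) p q‖ ≤ ∑ q, ∑ l, ‖A p l‖ * ‖(A ^ m) l q‖ := by
          refine Finset.sum_le_sum fun q _ => ?_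
          rw [pow_succ', Matrix.mul_apply]
          exact (norm_sum_le _ _).trans_eq (by simp)
      _ = ∑ l, ‖A p l‖ * ∑ q, ‖(A ^ m) l q‖ := by
          rw [Finset.sum_comm]
          simp [Finset.mul_sum]
      _ ≤ ∑ l, ‖A p l‖ * R ^ m :=
          Finset.sum_le_sum fun l _ => mul_le_mul_of_nonneg_left (ih l) (norm_nonneg _)
      _ ≤ R ^ (m + 1) := by
          rw [← Finset.sum_mul, pow_succ']
          exact mul_le_mul_of_nonneg_right (hA p) (by positivity)

theorem abs_eigenvalues_le_of_row_sum_le {ι : Type*} [Fintype ι] [DecidableEq ι]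
    {A : Matrix ι ι ℂ} (hA : A.IsHermitian) {R : ℝ} (hR : ∀ p, ∑ q, ‖A p q‖ ≤ R) (i : ι) :
    |hA.eigenvalues i| ≤ R := by
  have hev : Module.End.HasEigenvalue (Matrix.toLin' A) (hA.eigenvalues i : ℂ) := by
    rw [Module.End.hasEigenvalue_iff_mem_spectrum, Matrix.spectrum_toLin']
    exact (spectrum.algebraMap_mem_iff ℂ).2 (hA.eigenvalues_mem_spectrum_real i)
  obtain ⟨k, hk⟩ := eigenvalue_mem_ball hev
  rw [mem_closedBall_iff_norm] at hk
  have h1 := norm_le_norm_add_norm_sub' (hA.eigenvalues i : ℂ) (A k k)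
  have h2 := Finset.add_sum_erase Finset.univ (fun q => ‖A k q‖) (Finset.mem_univ k)
  have h3 := hR k
  rw [Complex.norm_real, Real.norm_eq_abs] at h1
  linarith

theorem trace_pow_eq_sum_eigenvalues_pow {ι : Type*} [Fintype ι] [DecidableEq ι]
    {A : Matrix ι ι ℂ} (hA : A.IsHermitian) (m : ℕ) :
    (A ^ m).trace = ((∑ i, hA.eigenvalues i ^ m : ℝ) : ℂ) := by
  conv_lhs => rw [hA.spectral_theorem, ← map_pow, Unitary.conjStarAlgAut_apply,
    Matrix.trace_mul_cycle, Unitary.coe_star_mul_self, one_mul, Matrix.diagonal_pow,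
    Matrix.trace_diagonal]
  simp

theorem card_near_boundary_le (n K : ℕ) :
    (Finset.univ.filter fun i : Fin n => ¬ (K ≤ (i : ℕ) ∧ i + K < n)).card ≤ 2 * K := by
  calc _ ≤ (Finset.range K ∪ Finset.Ico (n - K) n).card := by
        refine Finset.card_le_card_of_injOn (fun i => (i : ℕ)) ?_ Fin.val_injective.injOn
        intro i hi
        have := i.2
        simp only [Finset.coe_filter, Finset.mem_univ, true_and, Set.mem_ofPred_eq] at hi
        simp only [Finset.coe_union, Finset.coe_range, Finset.coe_Ico, Set.mem_union, Set.mem_Iio,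
          Set.mem_Ico]
        omega
    _ ≤ K + (n - (n - K)) := (Finset.card_union_le _ _).trans (by simp)
    _ ≤ 2 * K := by omega

theorem card_near_boundary_sq_le (n K : ℕ) :
    (Finset.univ.filter fun l : Fin n × Fin n =>
      ¬ ((K ≤ (l.1 : ℕ) ∧ l.1 + K < n) ∧ (K ≤ (l.2 : ℕ) ∧ l.2 + K < n))).card ≤
      4 * K * n := by
  have h := card_near_boundary_le n K
  set B := Finset.univ.filter fun i : Fin n => ¬ (K ≤ (i : ℕ) ∧ i + K < n) with hB
  calc _ ≤ (B ×ˢ Finset.univ ∪ Finset.univ ×ˢ B).card := by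
        refine Finset.card_le_card fun l hl => ?_
        simp only [Finset.mem_filter, Finset.mem_univ, true_and] at hl
        simp only [hB, Finset.mem_union, Finset.mem_product, Finset.mem_filter, Finset.mem_univ,
          true_and, and_true]
        exact not_and_or.1 hl
    _ ≤ B.card * n + n * B.card := (Finset.card_union_le _ _).trans (by simp)
    _ ≤ 2 * K * n + n * (2 * K) := by gcongr
    _ = 4 * K * n := by ring

theorem norm_trace_blockToeplitz_pow_sub_le (S : Finset (ℤ × ℤ)) (c : ℤ × ℤ → Matrix κ κ ℂ)
    (hc : ∀ s ∉ S, c s = 0) (N : ℕ) (hS : ∀ s ∈ S, |s.1| ≤ N ∧ |s.2| ≤ N) (m : ℕ) :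
    ∃ C : ℝ, ∀ n : ℕ, ‖(blockToeplitz c n ^ m).trace -
      (n : ℂ) ^ 2 * ∑ a, fourierCoeffSq (fun x y => (trigPoly S c x y ^ m) a a) 0‖ ≤ C * n := by
  set τ := ∑ a, fourierCoeffSq (fun x y => (trigPoly S c x y ^ m) a a) 0
  set D : ℝ := Fintype.card κ * coeffNormSum S c ^ m + ‖τ‖
  have hD : 0 ≤ D := by
    have := coeffNormSum_nonneg S c
    positivity
  refine ⟨4 * (N * m) * D, fun n => ?_⟩
  set P : Fin n × Fin n → Prop := fun l =>
    (N * m ≤ (l.1 : ℕ) ∧ l.1 + N * m < n) ∧ (N * m ≤ (l.2 : ℕ) ∧ l.2 + N * m < n) with hP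
  have hterm : ∀ l : Fin n × Fin n, ‖∑ a, (blockToeplitz c n ^ m) (l, a) (l, a) - τ‖ ≤
      if ¬ P l then D else 0 := by
    intro l
    by_cases hl : ¬ P l
    · rw [if_pos hl]
      refine (norm_sub_le _ _).trans (add_le_add_left ?_ _)
      refine (norm_sum_le _ _).trans ?_
      refine (Finset.sum_le_card_nsmul _ _ (coeffNormSum S c ^ m) fun a _ => ?_).trans_eq (by simp)
      exact (Finset.single_le_sum (f := fun q => ‖(blockToeplitz c n ^ m) (l, a) q‖)
        (fun _ _ => norm_nonneg _) (Finset.mem_univ _)).trans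
        (pow_row_sum_le _ (blockToeplitz_row_sum_le S c hc n) (coeffNormSum_nonneg S c) m _)
    · rw [if_neg hl]
      obtain ⟨⟨h1, h2⟩, h3, h4⟩ := not_not.1 hl
      rw [norm_le_zero_iff, sub_eq_zero]
      refine Finset.sum_congr rfl fun a _ => ?_
      rw [blockToeplitz_pow_apply S c hc N hS n m (l, a) (l, a) h1 h2 h3 h4]
      simp only [sub_self]
      rfl
  have hsum : (blockToeplitz c n ^ m).trace - (n : ℂ) ^ 2 * τ =
      ∑ l : Fin n × Fin n, (∑ a, (blockToeplitz c n ^ m) (l, a) (l, a) - τ) := by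
    rw [Finset.sum_sub_distrib, Matrix.trace, Fintype.sum_prod_type]
    simp [sq]
  rw [hsum]
  refine (norm_sum_le _ _).trans ((Finset.sum_le_sum fun l _ => hterm l).trans ?_)
  rw [← Finset.sum_filter, Finset.sum_const, nsmul_eq_mul]
  have hcard : ((Finset.univ.filter fun l => ¬ P l).card : ℝ) ≤ 4 * (N * m) * n := by
    exact_mod_cast card_near_boundary_sq_le n (N * m)
  calc _ ≤ 4 * (N * m) * n * D := mul_le_mul_of_nonneg_right hcard hD
    _ = _ := by ring

theorem tendsto_trace_blockToeplitz_pow (S : Finset (ℤ × ℤ)) (c : ℤ × ℤ → Matrix κ κ ℂ)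
    (hc : ∀ s ∉ S, c s = 0) (N : ℕ) (hS : ∀ s ∈ S, |s.1| ≤ N ∧ |s.2| ≤ N) (m : ℕ) :
    Tendsto (fun n : ℕ => (1 / (n : ℂ) ^ 2) * (blockToeplitz c n ^ m).trace) atTop
      (nhds (∑ a, fourierCoeffSq (fun x y => (trigPoly S c x y ^ m) a a) 0)) := by
  obtain ⟨C, hC⟩ := norm_trace_blockToeplitz_pow_sub_le S c hc N hS m
  rw [tendsto_iff_norm_sub_tendsto_zero]
  refine squeeze_zero' (Eventually.of_forall fun _ => norm_nonneg _) ?_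
    (tendsto_const_div_atTop_nhds_zero_nat C)
  filter_upwards [eventually_gt_atTop 0] with n hn
  have hn' : (0 : ℝ) < n := by exact_mod_cast hn
  have hnc : (n : ℂ) ≠ 0 := by exact_mod_cast hn.ne'
  have h := hC n
  set τ := ∑ a, fourierCoeffSq (fun x y => (trigPoly S c x y ^ m) a a) 0
  have hfac : (1 / (n : ℂ) ^ 2) * (blockToeplitz c n ^ m).trace - τ =
      (1 / (n : ℂ) ^ 2) * ((blockToeplitz c n ^ m).trace - (n : ℂ) ^ 2 * τ) := by
    field_simp
  rw [hfac, norm_mul, norm_div, norm_one, norm_pow, Complex.norm_natCast]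
  calc 1 / (n : ℝ) ^ 2 * _ ≤ 1 / (n : ℝ) ^ 2 * (C * n) := by gcongr
    _ = C / n := by field_simp

omit [DecidableEq κ] in
theorem abs_sum_sub_sum_le {u v : κ → ℝ} {ε : ℝ} (h : ∀ i, |u i - v i| ≤ ε) :
    |∑ i, u i - ∑ i, v i| ≤ Fintype.card κ * ε := by
  rw [← Finset.sum_sub_distrib]
  exact (Finset.abs_sum_le_sum_abs _ _).trans
    ((Finset.sum_le_card_nsmul _ _ ε fun i _ => h i).trans_eq (by simp))

theorem continuous_sum_eigenvalues_pow (S : Finset (ℤ × ℤ)) (c : ℤ × ℤ → Matrix κ κ ℂ)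
    (hf : ∀ x y, (trigPoly S c x y).IsHermitian) (m : ℕ) :
    Continuous fun x : ℝ × ℝ => ∑ i, (hf x.1 x.2).eigenvalues i ^ m := by
  have h := Complex.continuous_re.comp ((continuous_trigPoly S c).pow m).matrix_trace
  refine h.congr fun x => ?_
  simp only [Function.comp_apply, Pi.pow_apply]
  rw [trace_pow_eq_sum_eigenvalues_pow (hf x.1 x.2), Complex.ofReal_re]

theorem sum_eval_eq_sum_coeff_mul {ι : Type*} [Fintype ι] (p : Polynomial ℝ) (u : ι → ℝ) :
    ∑ i, p.eval (u i) =
      ∑ m ∈ Finset.range (p.natDegree + 1), p.coeff m * ∑ i, u i ^ m := by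
  simp only [Polynomial.eval_eq_sum_range, Finset.mul_sum]
  exact Finset.sum_comm

theorem continuous_sum_eval_eigenvalues (S : Finset (ℤ × ℤ)) (c : ℤ × ℤ → Matrix κ κ ℂ)
    (hf : ∀ x y, (trigPoly S c x y).IsHermitian) (p : Polynomial ℝ) :
    Continuous fun x : ℝ × ℝ => ∑ i, p.eval ((hf x.1 x.2).eigenvalues i) := by
  simp only [sum_eval_eq_sum_coeff_mul]
  exact continuous_finsetSum _ fun m _ =>
    (continuous_sum_eigenvalues_pow S c hf m).const_mul _

theorem exists_polynomial_near (F : ℝ → ℝ) (hF : Continuous F) (R : ℝ) {ε : ℝ} (hε : 0 < ε) :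
    ∃ p : Polynomial ℝ, ∀ x, |x| ≤ R → |F x - p.eval x| ≤ ε := by
  obtain ⟨p, hp⟩ := exists_polynomial_near_of_continuousOn (-R) R F hF.continuousOn ε hε
  refine ⟨p, fun x hx => ?_⟩
  rw [abs_sub_comm]
  exact (hp x (abs_le.1 hx)).le

theorem continuous_sum_eigenvalues (S : Finset (ℤ × ℤ)) (c : ℤ × ℤ → Matrix κ κ ℂ)
    (hf : ∀ x y, (trigPoly S c x y).IsHermitian) (F : ℝ → ℝ) (hF : Continuous F) :
    Continuous fun x : ℝ × ℝ => ∑ i, F ((hf x.1 x.2).eigenvalues i) := by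
  refine continuous_of_uniform_approx_of_continuous fun u hu => ?_
  obtain ⟨ε, hε, hu⟩ := Metric.mem_uniformity_dist.1 hu
  have hpos : (0 : ℝ) < Fintype.card κ + 1 := by positivity
  obtain ⟨p, hp⟩ := exists_polynomial_near F hF (coeffNormSum S c) (div_pos hε hpos)
  refine ⟨_, continuous_sum_eval_eigenvalues S c hf p, fun x => hu ?_⟩
  rw [Real.dist_eq]
  refine (abs_sum_sub_sum_le fun i => hp _ (abs_eigenvalues_le_of_row_sum_le (hf x.1 x.2)
    (trigPoly_row_sum_le S c x.1 x.2) i)).trans_lt ?_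
  rw [mul_div_assoc', div_lt_iff₀ hpos]
  nlinarith

theorem sum_fourierCoeffSq_trigPoly_pow (S : Finset (ℤ × ℤ)) (c : ℤ × ℤ → Matrix κ κ ℂ)
    (hf : ∀ x y, (trigPoly S c x y).IsHermitian) (m : ℕ) :
    ∑ a, fourierCoeffSq (fun x y => (trigPoly S c x y ^ m) a a) 0 =
      (((1 / (2 * Real.pi) ^ 2) * ∫ x in (-Real.pi)..Real.pi, ∫ y in (-Real.pi)..Real.pi,
        ∑ i, (hf x y).eigenvalues i ^ m : ℝ) : ℂ) := by
  rw [← fourierCoeffSq_sum _ _ fun a _ => continuous_trigPoly_pow_apply S c m a a, fourierCoeffSq]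
  push_cast
  simp only [← intervalIntegral.integral_ofReal]
  congr! 6 with x y
  have h := trace_pow_eq_sum_eigenvalues_pow (hf x y) m
  simp only [Prod.fst_zero, Prod.snd_zero, Int.cast_zero, zero_mul, add_zero, mul_zero, neg_zero,
    Complex.exp_zero, mul_one]
  exact h

theorem tendsto_eigenvalues_blockToeplitz_pow (S : Finset (ℤ × ℤ)) (c : ℤ × ℤ → Matrix κ κ ℂ)
    (hc : ∀ s ∉ S, c s = 0) (N : ℕ) (hS : ∀ s ∈ S, |s.1| ≤ N ∧ |s.2| ≤ N)
    (hT : ∀ n, (blockToeplitz c n).IsHermitian)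
    (hf : ∀ x y, (trigPoly S c x y).IsHermitian) (m : ℕ) :
    Tendsto (fun n : ℕ => (1 / (n : ℝ) ^ 2) * ∑ i, (hT n).eigenvalues i ^ m) atTop
      (nhds ((1 / (2 * Real.pi) ^ 2) *
        ∫ x in (-Real.pi)..Real.pi, ∫ y in (-Real.pi)..Real.pi,
          ∑ i, (hf x y).eigenvalues i ^ m)) := by
  have h := tendsto_trace_blockToeplitz_pow S c hc N hS m
  rw [sum_fourierCoeffSq_trigPoly_pow S c hf m] at h
  have h' := (Complex.continuous_re.tendsto _).comp h
  rw [Complex.ofReal_re] at h'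
  refine h'.congr fun n => ?_
  rw [Function.comp_apply, trace_pow_eq_sum_eigenvalues_pow (hT n) m, ← Complex.ofReal_natCast,
    ← Complex.ofReal_pow, ← Complex.ofReal_one, ← Complex.ofReal_div, ← Complex.ofReal_mul,
    Complex.ofReal_re]

theorem tendsto_eigenvalues_blockToeplitz_polynomial (S : Finset (ℤ × ℤ))
    (c : ℤ × ℤ → Matrix κ κ ℂ) (hc : ∀ s ∉ S, c s = 0) (N : ℕ)
    (hS : ∀ s ∈ S, |s.1| ≤ N ∧ |s.2| ≤ N) (hT : ∀ n, (blockToeplitz c n).IsHermitian)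
    (hf : ∀ x y, (trigPoly S c x y).IsHermitian) (p : Polynomial ℝ) :
    Tendsto (fun n : ℕ => (1 / (n : ℝ) ^ 2) * ∑ i, p.eval ((hT n).eigenvalues i)) atTop
      (nhds ((1 / (2 * Real.pi) ^ 2) *
        ∫ x in (-Real.pi)..Real.pi, ∫ y in (-Real.pi)..Real.pi,
          ∑ i, p.eval ((hf x y).eigenvalues i))) := by
  simp only [sum_eval_eq_sum_coeff_mul]
  rw [integral_integral_finset_sum _ _ fun m _ =>
    (continuous_sum_eigenvalues_pow S c hf m).const_mul _]
  have key : ∀ (t : ℝ) (u : ℕ → ℝ), t * ∑ m ∈ Finset.range (p.natDegree + 1), p.coeff m * u m =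
      ∑ m ∈ Finset.range (p.natDegree + 1), p.coeff m * (t * u m) := fun t u => by
    rw [Finset.mul_sum]
    exact Finset.sum_congr rfl fun m _ => mul_left_comm _ _ _
  simp only [intervalIntegral.integral_const_mul, key]
  exact tendsto_finsetSum _ fun m _ =>
    (tendsto_eigenvalues_blockToeplitz_pow S c hc N hS hT hf m).const_mul _

theorem abs_integral_integral_sub_le {g h : ℝ → ℝ → ℝ}
    (hg : Continuous fun x : ℝ × ℝ => g x.1 x.2) (hh : Continuous fun x : ℝ × ℝ => h x.1 x.2)
    {ε a b : ℝ} (hgh : ∀ x y, |g x y - h x y| ≤ ε) :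
    |(∫ x in a..b, ∫ y in a..b, g x y) - ∫ x in a..b, ∫ y in a..b, h x y| ≤
      ε * |b - a| ^ 2 := by
  have hgi := intervalIntegral.continuous_parametric_intervalIntegral_of_continuous'
    (μ := MeasureTheory.volume) (f := g) hg a b
  have hhi := intervalIntegral.continuous_parametric_intervalIntegral_of_continuous'
    (μ := MeasureTheory.volume) (f := h) hh a b
  rw [← intervalIntegral.integral_sub (hgi.intervalIntegrable _ _) (hhi.intervalIntegrable _ _),
    ← Real.norm_eq_abs, sq, ← mul_assoc]
  refine intervalIntegral.norm_integral_le_of_norm_le_const fun x _ => ?_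
  have hgx : Continuous (g x) := hg.comp (Continuous.prodMk_right x)
  have hhx : Continuous (h x) := hh.comp (Continuous.prodMk_right x)
  rw [← intervalIntegral.integral_sub (hgx.intervalIntegrable _ _) (hhx.intervalIntegrable _ _)]
  exact intervalIntegral.norm_integral_le_of_norm_le_const fun y _ => hgh x y

/-- The block Toeplitz matrices generated by a Hermitian matrix-valued trigonometric polynomial in
two variables are spectrally distributed as that polynomial. -/
theorem tendsto_eigenvalues_blockToeplitz (S : Finset (ℤ × ℤ))
    (c : ℤ × ℤ → Matrix κ κ ℂ) (hc : ∀ s ∉ S, c s = 0) (N : ℕ)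
    (hS : ∀ s ∈ S, |s.1| ≤ N ∧ |s.2| ≤ N) (hT : ∀ n, (blockToeplitz c n).IsHermitian)
    (hf : ∀ x y, (trigPoly S c x y).IsHermitian) (F : ℝ → ℝ) (hF : Continuous F) :
    Tendsto (fun n : ℕ => (1 / (n : ℝ) ^ 2) * ∑ i, F ((hT n).eigenvalues i)) atTop
      (nhds ((1 / (2 * Real.pi) ^ 2) *
        ∫ x in (-Real.pi)..Real.pi, ∫ y in (-Real.pi)..Real.pi,
          ∑ i, F ((hf x y).eigenvalues i))) := by
  rw [Metric.tendsto_nhds]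
  intro ε hε
  have hpos : (0 : ℝ) < 3 * (Fintype.card κ + 1) := by positivity
  set δ := ε / (3 * (Fintype.card κ + 1)) with hδ
  have hδ0 : 0 < δ := div_pos hε hpos
  have hδε : Fintype.card κ * δ < ε / 3 := by
    have : 3 * ((Fintype.card κ + 1) * δ) = ε := by rw [hδ]; field_simp
    linarith
  obtain ⟨p, hp⟩ := exists_polynomial_near F hF (coeffNormSum S c) hδ0
  have hlim := tendsto_eigenvalues_blockToeplitz_polynomial S c hc N hS hT hf p
  rw [Metric.tendsto_nhds] at hlim
  have hint := abs_integral_integral_sub_le (a := -Real.pi) (b := Real.pi)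
    (continuous_sum_eigenvalues S c hf F hF) (continuous_sum_eval_eigenvalues S c hf p)
    fun x y => abs_sum_sub_sum_le fun i => hp _ (abs_eigenvalues_le_of_row_sum_le (hf x y)
      (trigPoly_row_sum_le S c x y) i)
  rw [sq_abs, show Real.pi - -Real.pi = 2 * Real.pi by ring] at hint
  have hpi : 0 < (2 * Real.pi) ^ 2 := by positivity
  filter_upwards [hlim (ε / 3) (by positivity), eventually_gt_atTop 0] with n hn hn0
  have hn2 : (0 : ℝ) < (n : ℝ) ^ 2 := by positivity
  have hsum := abs_sum_sub_sum_le fun i => hp _ (abs_eigenvalues_le_of_row_sum_le (hT n)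
    (blockToeplitz_row_sum_le S c hc n) i)
  simp only [Fintype.card_prod, Fintype.card_fin, Nat.cast_mul] at hsum
  rw [Real.dist_eq] at hn ⊢
  have scale : ∀ {t u v B : ℝ}, 0 < t → |u - v| ≤ B * t → |1 / t * u - 1 / t * v| ≤ B :=
    fun {t u v B} ht h => by
      rw [← mul_sub, abs_mul, abs_of_pos (by positivity : 0 < 1 / t), one_div,
        inv_mul_le_iff₀ ht, mul_comm t]
      exact h
  have h1 := scale hn2 (hsum.trans_eq (by ring : _ = Fintype.card κ * δ * (n : ℝ) ^ 2))
  have h2 := scale hpi hint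
  rw [abs_le] at h1 h2
  rw [abs_lt] at hn ⊢
  constructor <;> linarith [hn.1, hn.2, h1.1, h1.2, h2.1, h2.2]

end Symbol

/-- The indices of the nonzero Fourier coefficients of `fP2`. -/
def suppP2 : Finset (ℤ × ℤ) := {(0, 0), (1, 0), (-1, 0), (0, 1), (0, -1)}

/-- The Fourier coefficients of `fP2` in closed form. -/
noncomputable def coeffP2 (s : ℤ × ℤ) : Matrix (Fin 4) (Fin 4) ℂ :=
  if s = (0, 0) then
    !![16 / 3, -4 / 3, -4 / 3, 0; -4 / 3, 16 / 3, 0, -4 / 3;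
       -4 / 3, 0, 16 / 3, -4 / 3; 0, -4 / 3, -4 / 3, 4]
  else if s = (1, 0) then !![0, -4 / 3, 0, 0; 0, 0, 0, 0; 0, 0, 0, -4 / 3; 0, 0, 0, 1 / 3]
  else if s = (-1, 0) then !![0, 0, 0, 0; -4 / 3, 0, 0, 0; 0, 0, 0, 0; 0, 0, -4 / 3, 1 / 3]
  else if s = (0, 1) then !![0, 0, -4 / 3, 0; 0, 0, 0, -4 / 3; 0, 0, 0, 0; 0, 0, 0, 1 / 3]
  else if s = (0, -1) then !![0, 0, 0, 0; 0, 0, 0, 0; -4 / 3, 0, 0, 0; 0, -4 / 3, 0, 1 / 3]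
  else 0

theorem coeffP2_eq_zero (s : ℤ × ℤ) (hs : s ∉ suppP2) : coeffP2 s = 0 := by
  simp only [suppP2, Finset.mem_insert, Finset.mem_singleton, not_or] at hs
  simp [coeffP2, hs]

theorem fP2_eq_trigPoly (x y : ℝ) : fP2 x y = trigPoly suppP2 coeffP2 x y := by
  have hcos : ∀ t : ℝ, Complex.cos t = (cexp (I * t) + cexp (-(I * t))) / 2 := fun t => by
    rw [Complex.cos]; congr 3 <;> ring_nf
  ext a b
  fin_cases a <;> fin_cases b <;>
    simp [fP2, trigPoly, suppP2, coeffP2, hcos] <;> ring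

theorem fhatP2_eq_coeffP2 (k1 k2 : ℤ) : fhatP2 k1 k2 = coeffP2 (k1, k2) := by
  ext a b
  rw [← fourierCoeffSq_trigPoly suppP2 coeffP2 coeffP2_eq_zero a b (k1, k2)]
  simp only [← fP2_eq_trigPoly]
  rfl

theorem TbP2_eq_blockToeplitz (n : ℕ) : TbP2 n = blockToeplitz coeffP2 n := by
  ext p q
  simp only [TbP2, blockToeplitz, Matrix.of_apply, fhatP2_eq_coeffP2]

/-- The matrix-sequence `{T_n(f_{P2})}_n` is spectrally distributed as `f_{P2}`: for every
continuous `F : ℝ → ℝ` with compact support,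
`(1/(4n²)) ∑_{i=1}^{4n²} F(λ_i(T_n(f_{P2}))) →
  (1/(4(2π)²)) ∫_{[−π,π]²} ∑_{i=1}^{4} F(λ_i(f_{P2}(θ1,θ2))) dθ1 dθ2`. -/
theorem stmt15 (hT : ∀ n, (TbP2 n).IsHermitian)
    (hf : ∀ θ1 θ2 : ℝ, (fP2 θ1 θ2).IsHermitian)
    (F : ℝ → ℝ) (hF : Continuous F) (hFc : HasCompactSupport F) :
    Tendsto (fun n : ℕ => (1 / (4 * (n : ℝ) ^ 2)) * ∑ i, F ((hT n).eigenvalues i)) atTop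
      (nhds ((1 / (4 * (2 * Real.pi) ^ 2)) *
        ∫ θ1 in (-Real.pi)..Real.pi, ∫ θ2 in (-Real.pi)..Real.pi,
          ∑ i : Fin 4, F ((hf θ1 θ2).eigenvalues i))) := by
  have hfun : fP2 = trigPoly suppP2 coeffP2 := funext₂ fP2_eq_trigPoly
  have hmat : TbP2 = blockToeplitz coeffP2 := funext TbP2_eq_blockToeplitz
  have hmain := tendsto_eigenvalues_blockToeplitz suppP2 coeffP2 coeffP2_eq_zero 1
    (by simp [suppP2]) (hmat ▸ hT) (hfun ▸ hf) F hF
  simp only [← hfun, ← hmat] at hmain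
  have h4 := hmain.const_mul (1 / 4)
  simp only [← mul_assoc, one_div_mul_one_div_rev] at h4
  simpa only [mul_comm (4 : ℝ)] using h4
end
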